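/- arXiv:1602.08059 — 4 statements merged into one kernel-verified Lean document; each statement's English description precedes it below -/
import Mathlib

section
/- Let p > 5 be a real number. Then there exist smooth even functions M, E_tt, E_rr, E_ωω : Γ₁ → ℝ and a smooth odd function E_tr : Γ₁ → ℝ, with M homogeneous of order −4/(p−1) and E_tt, E_tr, E_rr, E_ωω homogeneous of order −2(p+1)/(p−1), with E_rr − E_ωω vanishing to second order at r = 0, such that on Γ₁ (for r ≠ 0, with all identities involving 1/r interpreted away from r = 0): (i) (1/2)(−∂_tt M + ∂_rr M + (2/r)∂_r M) − (−E_tt + E_rr + 2E_ωω) > 0; (ii) ∂_t[(1/2)(−∂_tt M + ∂_rr M + (2/r)∂_r M) − (−E_tt + E_rr + 2E_ωω)] = (p+1)[−∂_t E_tt + ∂_r E_tr + (2/r)E_tr − (1/2)∂_t(−E_tt + E_rr + 2E_ωω)]; (iii) ∂_r[(1/2)(−∂_tt M + ∂_rr M + (2/r)∂_r M) − (−E_tt + E_rr + 2E_ωω)] = (p+1)[−∂_t E_tr + ∂_r E_rr + (2/r)(E_rr − E_ωω) − (1/2)∂_r(−E_tt + E_rr + 2E_ωω)]; (iv) E_ωω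 > 0 on Γ₁; (v) the 3×3 matrix [[M, (1/2)∂_t M, (1/2)∂_r M], [(1/2)∂_t M, E_tt, E_tr], [(1/2)∂_r M, E_tr, E_rr]] is strictly positive definite at every point of Γ₁ with r ≠ 0; and (vi) the 2×2 matrix [[M, (1/2)∂_t M], [(1/2)∂_t M, E_tt]] is strictly positive definite at every point of Γ₁ with r = 0. -/
open Real MeasureTheory

noncomputable section

/-- The `1+1`-dimensional light cone `Γ₁ = {(t,r) : t > 0, -t ≤ r ≤ t}`. -/
def Cone1 : Set (ℝ × ℝ) := {q | 0 < q.1 ∧ |q.2| ≤ q.1}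

/-- The partial derivative `∂_t` on `ℝ × ℝ`. -/
def pdt (f : ℝ × ℝ → ℝ) : ℝ × ℝ → ℝ := fun q => fderiv ℝ f q (1, 0)

/-- The partial derivative `∂_r` on `ℝ × ℝ`. -/
def pdr (f : ℝ × ℝ → ℝ) : ℝ × ℝ → ℝ := fun q => fderiv ℝ f q (0, 1)

/-- `f` is even in `r` on `Γ₁`. -/
def IsEvenR (f : ℝ × ℝ → ℝ) : Prop := ∀ q ∈ Cone1, f (q.1, -q.2) = f q

/-- `f` is odd in `r` on `Γ₁`. -/
def IsOddR (f : ℝ × ℝ → ℝ) : Prop := ∀ q ∈ Cone1, f (q.1, -q.2) = -f q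

/-- `f` is homogeneous of order `α` on `Γ₁`. -/
def HomogOrder (α : ℝ) (f : ℝ × ℝ → ℝ) : Prop :=
  ∀ l : ℝ, 0 < l → ∀ q ∈ Cone1, f (l • q) = l ^ α * f q

/-- `g` vanishes to `k`-th order at `r = 0`: `g, ∂_r g, …, ∂_r^{k-1} g` all vanish at
`(t, 0)` for every `t > 0`. -/
def VanishOrder (k : ℕ) (g : ℝ × ℝ → ℝ) : Prop :=
  ∀ t : ℝ, 0 < t → ∀ j < k, (pdr^[j] g) (t, 0) = 0

/-- `f` is smooth on `Γ₁`: it is smooth on some open neighbourhood of `Γ₁`. -/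
def SmoothOnCone1 (f : ℝ × ℝ → ℝ) : Prop :=
  ∃ Ω : Set (ℝ × ℝ), IsOpen Ω ∧ Cone1 ⊆ Ω ∧ ContDiffOn ℝ (⊤ : ℕ∞) f Ω

/-- The defocusing quantity
`(1/2)(-∂_tt M + ∂_rr M + (2/r)∂_r M) - (-E_tt + E_rr + 2 E_ωω)` (for `d = 3`). -/
def defocusQty (M Ett Err Eww : ℝ × ℝ → ℝ) : ℝ × ℝ → ℝ :=
  fun q => (1 / 2) * (-(pdt (pdt M) q) + pdr (pdr M) q + (2 / q.2) * pdr M q)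
    - (-(Ett q) + Err q + 2 * Eww q)

/-- The `3×3` matrix of (v). -/
def mat3 (M Ett Err Etr : ℝ × ℝ → ℝ) (q : ℝ × ℝ) : Matrix (Fin 3) (Fin 3) ℝ :=
  !![M q, (1 / 2) * pdt M q, (1 / 2) * pdr M q;
     (1 / 2) * pdt M q, Ett q, Etr q;
     (1 / 2) * pdr M q, Etr q, Err q]

/-- The `2×2` matrix of (vi). -/
def mat2 (M Ett : ℝ × ℝ → ℝ) (q : ℝ × ℝ) : Matrix (Fin 2) (Fin 2) ℝ :=
  !![M q, (1 / 2) * pdt M q;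
     (1 / 2) * pdt M q, Ett q]

/-- The self-similar function `t ^ β * P (r / t)` of order `β` with profile `P`. -/
def selfSimilar (β : ℝ) (P : ℝ → ℝ) : ℝ × ℝ → ℝ := fun q => q.1 ^ β * P (q.2 / q.1)

lemma hasFDerivAt_selfSimilar {β P' : ℝ} {P : ℝ → ℝ} {q : ℝ × ℝ} (hq : 0 < q.1)
    (hP : HasDerivAt P P' (q.2 / q.1)) :
    HasFDerivAt (selfSimilar β P)
      ((q.1 ^ (β - 1) * (β * P (q.2 / q.1) - q.2 / q.1 * P')) • ContinuousLinearMap.fst ℝ ℝ ℝ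
        + (q.1 ^ (β - 1) * P') • ContinuousLinearMap.snd ℝ ℝ ℝ) q := by
  have h1 : HasFDerivAt (fun z : ℝ × ℝ => z.1) (ContinuousLinearMap.fst ℝ ℝ ℝ) q := hasFDerivAt_fst
  have h2 : HasFDerivAt (fun z : ℝ × ℝ => z.2) (ContinuousLinearMap.snd ℝ ℝ ℝ) q := hasFDerivAt_snd
  have h3 := h1.rpow_const (p := β) (Or.inl hq.ne')
  have h4 := h2.mul ((hasDerivAt_inv hq.ne').comp_hasFDerivAt q h1)
  have h5 := h3.mul (HasDerivAt.comp_hasFDerivAt q (f := fun z : ℝ × ℝ => z.2 * z.1⁻¹)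
    (by simpa [div_eq_mul_inv] using hP) h4)
  have hs : q.1 ^ β = q.1 ^ (β - 1) * q.1 := by
    rw [← Real.rpow_add_one hq.ne']; ring_nf
  have hfun : selfSimilar β P = (fun z : ℝ × ℝ => z.1 ^ β) * (P ∘ fun z : ℝ × ℝ => z.2 * z.1⁻¹) := by
    funext z
    simp [selfSimilar, div_eq_mul_inv]
  rw [hfun]
  refine h5.congr_fderiv ?_
  ext <;> simp [hs, div_eq_mul_inv] <;> field_simp
  ring

lemma pdt_selfSimilar {β : ℝ} {P : ℝ → ℝ} {q : ℝ × ℝ} {P' : ℝ} (hq : 0 < q.1)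
    (hP : HasDerivAt P P' (q.2 / q.1)) :
    pdt (selfSimilar β P) q = q.1 ^ (β - 1) * (β * P (q.2 / q.1) - q.2 / q.1 * P') := by
  simp [pdt, (hasFDerivAt_selfSimilar hq hP).fderiv]

lemma pdr_selfSimilar {β : ℝ} {P : ℝ → ℝ} {q : ℝ × ℝ} {P' : ℝ} (hq : 0 < q.1)
    (hP : HasDerivAt P P' (q.2 / q.1)) :
    pdr (selfSimilar β P) q = q.1 ^ (β - 1) * P' := by
  simp [pdr, (hasFDerivAt_selfSimilar hq hP).fderiv]

lemma isOpen_fst_pos : IsOpen {q : ℝ × ℝ | 0 < q.1} := isOpen_lt continuous_const continuous_fst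

lemma pdt_congr {f g : ℝ × ℝ → ℝ} (h : ∀ q : ℝ × ℝ, 0 < q.1 → f q = g q) {q : ℝ × ℝ}
    (hq : 0 < q.1) : pdt f q = pdt g q := by
  have : f =ᶠ[nhds q] g := Filter.eventually_of_mem (isOpen_fst_pos.mem_nhds hq) h
  simp [pdt, this.fderiv_eq]

lemma pdr_congr {f g : ℝ × ℝ → ℝ} (h : ∀ q : ℝ × ℝ, 0 < q.1 → f q = g q) {q : ℝ × ℝ}
    (hq : 0 < q.1) : pdr f q = pdr g q := by
  have : f =ᶠ[nhds q] g := Filter.eventually_of_mem (isOpen_fst_pos.mem_nhds hq) h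
  simp [pdr, this.fderiv_eq]

lemma smoothOnCone1_selfSimilar (β : ℝ) {P : ℝ → ℝ} (hP : ContDiff ℝ (⊤ : ℕ∞) P) :
    SmoothOnCone1 (selfSimilar β P) := by
  refine ⟨{q | 0 < q.1}, isOpen_fst_pos, fun q hq => hq.1, ?_⟩
  refine (contDiff_fst.contDiffOn.rpow_const_of_ne fun q hq => ne_of_gt hq).mul ?_
  exact hP.comp_contDiffOn
    (contDiff_snd.contDiffOn.div contDiff_fst.contDiffOn fun q hq => ne_of_gt hq)

lemma homogOrder_selfSimilar (β : ℝ) (P : ℝ → ℝ) : HomogOrder β (selfSimilar β P) := by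
  intro l hl q hq
  simp only [selfSimilar, Prod.smul_fst, Prod.smul_snd, smul_eq_mul]
  rw [Real.mul_rpow hl.le hq.1.le, mul_div_mul_left _ _ hl.ne', mul_assoc]

lemma isEvenR_selfSimilar (β : ℝ) {P : ℝ → ℝ} (hP : ∀ x, P (-x) = P x) :
    IsEvenR (selfSimilar β P) := by
  intro q _
  simp [selfSimilar, neg_div, hP]

lemma isOddR_selfSimilar (β : ℝ) {P : ℝ → ℝ} (hP : ∀ x, P (-x) = -P x) :
    IsOddR (selfSimilar β P) := by
  intro q _
  simp [selfSimilar, neg_div, hP]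

/-- The even polynomial profile `A + B x² + C x^(2m+2) + D x^(2m+4)`. -/
def evenProfile (m : ℕ) (A B C D : ℝ) : ℝ → ℝ :=
  fun x => A + B * x ^ 2 + C * x ^ (2 * m + 2) + D * x ^ (2 * m + 4)

/-- The odd polynomial profile `A x + C x^(2m+3)`. -/
def oddProfile (m : ℕ) (A C : ℝ) : ℝ → ℝ := fun x => A * x + C * x ^ (2 * m + 3)

lemma hasDerivAt_evenProfile (m : ℕ) (A B C D x : ℝ) :
    HasDerivAt (evenProfile m A B C D) (B * (2 * x) + C * ((2 * m + 2) * x ^ (2 * m + 1))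
      + D * ((2 * m + 4) * x ^ (2 * m + 3))) x := by
  have h := ((((hasDerivAt_pow 2 x).const_mul B).const_add A).add
    ((hasDerivAt_pow (2 * m + 2) x).const_mul C)).add
    ((hasDerivAt_pow (2 * m + 4) x).const_mul D)
  refine h.congr_deriv ?_
  simp

lemma hasDerivAt_oddProfile (m : ℕ) (A C x : ℝ) :
    HasDerivAt (oddProfile m A C) (A + C * ((2 * m + 3) * x ^ (2 * m + 2))) x := by
  have h := ((hasDerivAt_id x).const_mul A).add ((hasDerivAt_pow (2 * m + 3) x).const_mul C)
  refine h.congr_deriv ?_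
  simp

lemma contDiff_evenProfile (m : ℕ) (A B C D : ℝ) :
    ContDiff ℝ (⊤ : ℕ∞) (evenProfile m A B C D) := by
  unfold evenProfile; fun_prop

lemma contDiff_oddProfile (m : ℕ) (A C : ℝ) : ContDiff ℝ (⊤ : ℕ∞) (oddProfile m A C) := by
  unfold oddProfile; fun_prop

lemma evenProfile_neg (m : ℕ) (A B C D x : ℝ) :
    evenProfile m A B C D (-x) = evenProfile m A B C D x := by
  have h2 : Even (2 * m + 2) := ⟨m + 1, by ring⟩
  have h4 : Even (2 * m + 4) := ⟨m + 2, by ring⟩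
  simp [evenProfile, h2.neg_pow, h4.neg_pow]

lemma oddProfile_neg (m : ℕ) (A C x : ℝ) : oddProfile m A C (-x) = -oddProfile m A C x := by
  have h3 : Odd (2 * m + 3) := ⟨m + 1, by ring⟩
  simp only [oddProfile, h3.neg_pow]
  ring

lemma posDef_mat2_of {A B C : ℝ} (hA : 0 < A) (h : B ^ 2 < A * C) :
    (!![A, B; B, C] : Matrix (Fin 2) (Fin 2) ℝ).PosDef := by
  refine Matrix.PosDef.of_dotProduct_mulVec_pos ?_ ?_
  · ext i j; fin_cases i <;> fin_cases j <;> rfl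
  · intro x hx
    have key : 0 < A * (A * x 0 ^ 2 + 2 * B * x 0 * x 1 + C * x 1 ^ 2) := by
      have e : A * (A * x 0 ^ 2 + 2 * B * x 0 * x 1 + C * x 1 ^ 2)
          = (A * x 0 + B * x 1) ^ 2 + (A * C - B ^ 2) * x 1 ^ 2 := by ring
      rw [e]
      by_cases h1 : x 1 = 0
      · have h0 : x 0 ≠ 0 := by
          intro h0; apply hx; ext i; fin_cases i <;> simp [h0, h1]
        have : A * x 0 ≠ 0 := mul_ne_zero hA.ne' h0
        have := sq_pos_iff.mpr this
        rw [h1]; linarith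
      · have : 0 < A * C - B ^ 2 := by linarith
        positivity
    have := pos_of_mul_pos_right key hA.le
    simp [Matrix.mulVec, dotProduct, Fin.sum_univ_two]
    linarith

lemma posDef_mat3_of {A B C D F J : ℝ} (hA : 0 < A) (hD : 0 < D) (h : A * D ≤ A * C - B ^ 2)
    (hJ : J ^ 2 < D * F) :
    (!![A, B, 0; B, C, J; 0, J, F] : Matrix (Fin 3) (Fin 3) ℝ).PosDef := by
  refine Matrix.PosDef.of_dotProduct_mulVec_pos ?_ ?_
  · ext i j; fin_cases i <;> fin_cases j <;> rfl
  · intro x hx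
    have key : 0 < A * D * (A * x 0 ^ 2 + 2 * B * x 0 * x 1 + C * x 1 ^ 2
        + 2 * J * x 1 * x 2 + F * x 2 ^ 2) := by
      have e : A * D * (A * x 0 ^ 2 + 2 * B * x 0 * x 1 + C * x 1 ^ 2
          + 2 * J * x 1 * x 2 + F * x 2 ^ 2)
          = D * (A * x 0 + B * x 1) ^ 2 + D * (A * C - B ^ 2 - A * D) * x 1 ^ 2
            + A * (D * x 1 + J * x 2) ^ 2 + A * (D * F - J ^ 2) * x 2 ^ 2 := by ring
      rw [e]
      have n1 : 0 ≤ A * C - B ^ 2 - A * D := by linarith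
      have n2 : 0 < D * F - J ^ 2 := by linarith
      by_cases h2 : x 2 = 0
      · by_cases h1 : x 1 = 0
        · have h0 : x 0 ≠ 0 := by
            intro h0; apply hx; ext i; fin_cases i <;> simp [h0, h1, h2]
          have : A * x 0 ≠ 0 := mul_ne_zero hA.ne' h0
          have := mul_pos hD (sq_pos_iff.mpr this)
          rw [h1, h2]; linarith
        · have : D * x 1 ≠ 0 := mul_ne_zero hD.ne' h1
          have := mul_pos hA (sq_pos_iff.mpr this)
          have : 0 ≤ D * (A * x 0 + B * x 1) ^ 2 := by positivity
          have : 0 ≤ D * (A * C - B ^ 2 - A * D) * x 1 ^ 2 := by positivity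
          rw [h2]; linarith
      · positivity
    have := pos_of_mul_pos_right key (by positivity)
    simp [Matrix.mulVec, dotProduct, Fin.sum_univ_three]
    linarith

/-- Positivity of the angular energy profile, with `y = x²` and `z = x^(2m+2)`. -/
lemma angular_profile_pos {α L y z d ρ : ℝ} (hα : 0 < α) (hα1 : α < 1) (hL : 0 ≤ L)
    (hLα : 6 ≤ (2 * L + 7) * (1 - α)) (hd : 0 < d) (hρ : ρ ≤ d / 6)
    (hy : y ∈ Set.Icc (0 : ℝ) 1) (hz : 0 ≤ z) (hyz : 1 / 2 ≤ y → 2 * d ≤ z * (1 - α)) :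
    0 < d - ρ - d * ((3 + α) * (2 + α) / 5) / 2 * y + (L + 2) * z
      - (2 * L + 5 + α) * (2 * L + 4 + α) / (2 * L + 7) / 2 * (z * y) := by
  obtain ⟨hy0, hy1⟩ := hy
  have k3 : (3 + α) * (2 + α) / 5 ≤ 12 / 5 := by nlinarith
  set κ := (2 * L + 5 + α) * (2 * L + 4 + α) / (2 * L + 7) with hκ
  have kn : κ ≤ 2 * L + 4 - (1 - α) := by
    rw [hκ, div_le_iff₀ (by linarith)]; nlinarith
  have e1 : d * ((3 + α) * (2 + α) / 5) / 2 * y ≤ d * y * (6 / 5) := by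
    have := mul_le_mul_of_nonneg_left k3 (mul_nonneg hd.le hy0); linarith
  have e2 : κ / 2 * (z * y) ≤ (L + 2 - (1 - α) / 2) * z := by
    have h1 := mul_le_mul_of_nonneg_right kn (mul_nonneg hz hy0)
    have h2 : (2 * L + 4 - (1 - α)) * (z * y) ≤ (2 * L + 4 - (1 - α)) * z := by
      apply mul_le_mul_of_nonneg_left _ (by linarith)
      nlinarith
    linarith
  have e3 : 0 ≤ z * (1 - α) := mul_nonneg hz (by linarith)
  rcases le_total y (1 / 2) with h | h
  · nlinarith
  · have := hyz h
    nlinarith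

/-- The determinant inequality between the energy profile and the momentum profile. -/
lemma momentum_sq_lt {α L y z d ρ : ℝ} (hα : 0 < α) (hα1 : α < 1) (hL : 0 ≤ L)
    (hd : 0 < d) (hρ : ρ ≤ d / 6) (hy : y ∈ Set.Icc (0 : ℝ) 1) (hz : 0 ≤ z) :
    y * ((α + 2) * d + (α + 4 + 2 * L) * z) ^ 2 < (3 * d + (2 * L + 5) * z) *
      (d - ρ + d * ((3 + α) * (2 + α) / 5) * y + z
        + (2 * L + 5 + α) * (2 * L + 4 + α) / (2 * L + 7) * (z * y)) := by
  obtain ⟨hy0, hy1⟩ := hy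
  set κ := (2 * L + 5 + α) * (2 * L + 4 + α) / (2 * L + 7) with hκ
  have hκe : κ * (2 * L + 7) = (2 * L + 5 + α) * (2 * L + 4 + α) := by
    rw [hκ]; field_simp
  set κ₃ := (3 + α) * (2 + α) / 5 with hκ₃
  have c1 : 1 ≤ 3 + 3 * κ₃ - (α + 2) ^ 2 := by rw [hκ₃]; nlinarith
  have c2 : (2 * L + 5) / 4 ≤ 3 + 3 * κ + (2 * L + 5) * (1 + κ₃)
      - 2 * (α + 2) * (α + 4 + 2 * L) := by
    have hb : (3 + 3 * κ + (2 * L + 5) * (1 + κ₃) - 2 * (α + 2) * (α + 4 + 2 * L)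
        - (2 * L + 5) / 4) * (2 * L + 7)
        = (19 / 20 * (2 * L + 5) ^ 2 - (2 * L + 5) / 10 + 14) * (1 - α) ^ 2
          + 2 * (9 / 20 * (2 * L + 5) ^ 2 + 9 / 10 * (2 * L + 5) + 21 / 2) * (α * (1 - α))
          + (3 / 20 * (2 * L + 5) ^ 2 + 3 / 10 * (2 * L + 5) + 6) * α ^ 2 := by
      rw [hκ₃]
      linear_combination 3 * hκe
    have h0 : 0 ≤ 19 / 20 * (2 * L + 5) ^ 2 - (2 * L + 5) / 10 + 14 := by nlinarith
    have h1 : 0 ≤ α * (1 - α) := mul_nonneg hα.le (by linarith)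
    have : 0 ≤ (3 + 3 * κ + (2 * L + 5) * (1 + κ₃) - 2 * (α + 2) * (α + 4 + 2 * L)
        - (2 * L + 5) / 4) * (2 * L + 7) := by
      rw [hb]; positivity
    linarith [nonneg_of_mul_nonneg_left this (by linarith)]
  have c3 : 0 ≤ (2 * L + 5) * (1 + κ) - (α + 4 + 2 * L) ^ 2 := by
    have : 0 ≤ ((2 * L + 5) * (1 + κ) - (α + 4 + 2 * L) ^ 2) * (2 * L + 7) := by
      have : ((2 * L + 5) * (1 + κ) - (α + 4 + 2 * L) ^ 2) * (2 * L + 7)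
        = (2 * L + 5) * (2 * L + 7) - (2 * L + 4 + α) * (2 * L + 3 + 2 * α) := by
        linear_combination (2 * L + 5) * hκe
      rw [this]; nlinarith
    exact nonneg_of_mul_nonneg_left this (by linarith)
  have d1 : 1 ≤ 3 + y * (3 * κ₃ - (α + 2) ^ 2) := by nlinarith
  have d2 : (2 * L + 5) / 4 ≤ 3 + (2 * L + 5) + y * (3 * κ + (2 * L + 5) * κ₃
      - 2 * (α + 2) * (α + 4 + 2 * L)) := by nlinarith
  have d3 : 0 ≤ (2 * L + 5) + y * ((2 * L + 5) * κ - (α + 4 + 2 * L) ^ 2) := by nlinarith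
  have f1 := mul_le_mul_of_nonneg_right d1 (mul_nonneg hd.le hd.le)
  have f2 := mul_le_mul_of_nonneg_right d2 (mul_nonneg hd.le hz)
  have f3 := mul_nonneg d3 (mul_nonneg hz hz)
  have g0 : 0 ≤ 3 * d + (2 * L + 5) * z := by positivity
  have g := mul_le_mul_of_nonneg_left hρ g0
  have g1 := mul_pos hd hd
  have g2 : 0 ≤ L * (d * z) := by positivity
  have g3 : 0 ≤ d * z := by positivity
  nlinarith

/-- Theorem 5.1, fourth reduction. -/
theorem stmt8 (p : ℝ) (hp : 5 < p) :
    ∃ M Ett Err Eww Etr : ℝ × ℝ → ℝ,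
      SmoothOnCone1 M ∧ SmoothOnCone1 Ett ∧ SmoothOnCone1 Err ∧
      SmoothOnCone1 Eww ∧ SmoothOnCone1 Etr ∧
      IsEvenR M ∧ IsEvenR Ett ∧ IsEvenR Err ∧ IsEvenR Eww ∧ IsOddR Etr ∧
      HomogOrder (-(4 / (p - 1))) M ∧
      HomogOrder (-(2 * (p + 1) / (p - 1))) Ett ∧
      HomogOrder (-(2 * (p + 1) / (p - 1))) Etr ∧
      HomogOrder (-(2 * (p + 1) / (p - 1))) Err ∧
      HomogOrder (-(2 * (p + 1) / (p - 1))) Eww ∧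
      -- `E_rr - E_ωω` vanishes to second order at `r = 0`
      VanishOrder 2 (fun q => Err q - Eww q) ∧
      -- (i) the defocusing inequality (away from `r = 0`)
      (∀ q ∈ Cone1, q.2 ≠ 0 → 0 < defocusQty M Ett Err Eww q) ∧
      -- (ii)
      (∀ q ∈ Cone1, q.2 ≠ 0 →
        pdt (defocusQty M Ett Err Eww) q
          = (p + 1) * (-(pdt Ett q) + pdr Etr q + (2 / q.2) * Etr q
              - (1 / 2) * pdt (fun z => -(Ett z) + Err z + 2 * Eww z) q)) ∧
      -- (iii)
      (∀ q ∈ Cone1, q.2 ≠ 0 →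
        pdr (defocusQty M Ett Err Eww) q
          = (p + 1) * (-(pdt Etr q) + pdr Err q + (2 / q.2) * (Err q - Eww q)
              - (1 / 2) * pdr (fun z => -(Ett z) + Err z + 2 * Eww z) q)) ∧
      -- (iv)
      (∀ q ∈ Cone1, 0 < Eww q) ∧
      -- (v)
      (∀ q ∈ Cone1, q.2 ≠ 0 → (mat3 M Ett Err Etr q).PosDef) ∧
      -- (vi)
      (∀ q ∈ Cone1, q.2 = 0 → (mat2 M Ett q).PosDef) := by
  set α := 4 / (p - 1) with hα
  have hp1 : 0 < p - 1 := by linarith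
  have hα0 : 0 < α := by positivity
  have hα1 : α < 1 := by rw [hα, div_lt_one hp1]; linarith
  have hexp : -(2 * (p + 1) / (p - 1)) = -α - 2 := by rw [hα]; field_simp; ring
  rw [hexp]
  obtain ⟨m, hm⟩ := exists_nat_ge (6 / (1 - α))
  have hLα : 6 ≤ (2 * (m : ℝ) + 7) * (1 - α) := by
    rw [div_le_iff₀ (by linarith)] at hm
    nlinarith [(Nat.cast_nonneg m : (0 : ℝ) ≤ m)]
  have hL : (0 : ℝ) ≤ m := Nat.cast_nonneg m
  obtain ⟨d, hd⟩ : ∃ d : ℝ, d = (1 - α) / 2 ^ (m + 2) := ⟨_, rfl⟩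
  have hd0 : 0 < d := by rw [hd]; exact div_pos (by linarith) (by positivity)
  obtain ⟨ε, hε⟩ : ∃ ε : ℝ, ε = d / 2 := ⟨_, rfl⟩
  have hε0 : 0 < ε := by linarith
  obtain ⟨v, hv⟩ : ∃ v : ℝ, v = ε / (p + 3) := ⟨_, rfl⟩
  have hv0 : 0 < v := by rw [hv]; exact div_pos hε0 (by linarith)
  have hvp : (p + 3) * v = ε := by rw [hv]; field_simp
  obtain ⟨μ, hμ⟩ : ∃ μ : ℝ, μ = (p - 1) * v / 2 + ε * α * (α + 1) / 4 := ⟨_, rfl⟩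
  obtain ⟨ρ, hρ⟩ : ∃ ρ : ℝ, ρ = (p + 3) * v / 6 + ε * α * (α + 1) / 12 := ⟨_, rfl⟩
  have hρd : ρ ≤ d / 6 := by
    rw [hρ, hvp]
    have : α * (α + 1) ≤ 2 := by nlinarith
    nlinarith
  obtain ⟨κ₃, hκ₃⟩ : ∃ κ₃ : ℝ, κ₃ = (3 + α) * (2 + α) / 5 := ⟨_, rfl⟩
  obtain ⟨κ, hκ⟩ : ∃ κ : ℝ, κ = (2 * m + 5 + α) * (2 * m + 4 + α) / (2 * m + 7) := ⟨_, rfl⟩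
  have hκe : κ * (2 * m + 7) = (2 * m + 5 + α) * (2 * m + 4 + α) := by
    rw [hκ]; field_simp
  have hM : ∀ q : ℝ × ℝ, 0 < q.1 → pdt (selfSimilar (-α) fun _ => ε) q
      = selfSimilar (-α - 1) (fun _ => -α * ε) q := by
    intro q hq
    simp [pdt_selfSimilar hq (hasDerivAt_const _ ε), selfSimilar]
  have hMr : ∀ q : ℝ × ℝ, 0 < q.1 → pdr (selfSimilar (-α) fun _ => ε) q = 0 := by
    intro q hq
    simp [pdr_selfSimilar hq (hasDerivAt_const _ ε)]
  have hMtt : ∀ q : ℝ × ℝ, 0 < q.1 → pdt (pdt (selfSimilar (-α) fun _ => ε)) q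
      = q.1 ^ (-α - 2) * (α * (α + 1) * ε) := by
    intro q hq
    rw [pdt_congr hM hq, pdt_selfSimilar hq (hasDerivAt_const _ (-α * ε)),
      show -α - 1 - 1 = -α - 2 by ring]
    ring
  have hMrr : ∀ q : ℝ × ℝ, 0 < q.1 → pdr (pdr (selfSimilar (-α) fun _ => ε)) q = 0 := by
    intro q hq
    rw [pdr_congr hMr hq]
    simp [pdr]
  set a := evenProfile m (3 * d + μ) 0 (2 * m + 5) 0 with ha
  set b := evenProfile m (d - ρ) (d * κ₃) 1 κ with hb
  set w := evenProfile m (d - ρ) (-(d * κ₃ / 2)) (m + 2) (-(κ / 2)) with hw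
  set j := oddProfile m (-((α + 2) * d)) (-(α + 4 + 2 * m)) with hj
  have htrace : ∀ x, -a x + b x + 2 * w x
      = -(1 / 2) * (α * (α + 1) * ε) - (p + 1) * v := by
    intro x
    simp only [ha, hb, hw, evenProfile, hμ, hρ]
    ring
  have htrace' : (fun z => -(selfSimilar (-α - 2) a z) + selfSimilar (-α - 2) b z
      + 2 * selfSimilar (-α - 2) w z)
      = selfSimilar (-α - 2) fun _ => -(1 / 2) * (α * (α + 1) * ε) - (p + 1) * v := by
    funext z
    rw [selfSimilar, selfSimilar, selfSimilar, selfSimilar, ← htrace (z.2 / z.1)]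
    ring
  have hD : ∀ q : ℝ × ℝ, 0 < q.1 → defocusQty (selfSimilar (-α) fun _ => ε)
      (selfSimilar (-α - 2) a) (selfSimilar (-α - 2) b) (selfSimilar (-α - 2) w) q
      = selfSimilar (-α - 2) (fun _ => (p + 1) * v) q := by
    intro q hq
    have := congrFun htrace' q
    rw [defocusQty, this, hMtt q hq, hMrr q hq, hMr q hq, selfSimilar, selfSimilar]
    ring
  have hda := hasDerivAt_evenProfile m (3 * d + μ) 0 (2 * m + 5) 0
  have hdb := hasDerivAt_evenProfile m (d - ρ) (d * κ₃) 1 κ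
  have hdw := hasDerivAt_evenProfile m (d - ρ) (-(d * κ₃ / 2)) (m + 2) (-(κ / 2))
  have hdj := hasDerivAt_oddProfile m (-((α + 2) * d)) (-(α + 4 + 2 * m))
  rw [← ha] at hda
  rw [← hb] at hdb
  rw [← hw] at hdw
  rw [← hj] at hdj
  -- rescaled coordinates `x = r / t` on the cone
  have hx : ∀ q ∈ Cone1, (q.2 / q.1) ^ 2 ∈ Set.Icc (0 : ℝ) 1 := by
    rintro q ⟨hq, hqr⟩
    refine ⟨by positivity, ?_⟩
    rw [sq_le_one_iff_abs_le_one, abs_div, abs_of_pos hq, div_le_one hq]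
    exact hqr
  have hpow : ∀ x : ℝ, x ^ (2 * m + 2) = (x ^ 2) ^ (m + 1) := fun x => by rw [← pow_mul]; ring_nf
  have hpow4 : ∀ x : ℝ, x ^ (2 * m + 4) = x ^ (2 * m + 2) * x ^ 2 := fun x => by
    rw [← pow_add]
  have hpow3 : ∀ x : ℝ, x ^ (2 * m + 3) = x * x ^ (2 * m + 2) := fun x => by ring
  have hz : ∀ x : ℝ, 0 ≤ x ^ (2 * m + 2) := fun x => by rw [hpow]; positivity
  have hzd : ∀ x : ℝ, 1 / 2 ≤ x ^ 2 → 2 * d ≤ x ^ (2 * m + 2) * (1 - α) := by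
    intro x hx
    have h1 : (1 / 2 : ℝ) ^ (m + 1) ≤ x ^ (2 * m + 2) := by
      rw [hpow]; exact pow_le_pow_left₀ (by norm_num) hx _
    have h2 : 2 * d = (1 / 2 : ℝ) ^ (m + 1) * (1 - α) := by
      rw [hd, one_div, inv_pow]; field_simp; ring
    rw [h2]
    exact mul_le_mul_of_nonneg_right h1 (by linarith)
  have hs2 : ∀ t : ℝ, 0 < t → t ^ (-α) = t ^ (-α - 2) * t ^ 2 := by
    intro t ht
    rw [← Real.rpow_natCast t 2, ← Real.rpow_add ht]; congr 1; push_cast; ring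
  have hs1 : ∀ t : ℝ, 0 < t → t ^ (-α - 1) = t ^ (-α - 2) * t := by
    intro t ht
    rw [← Real.rpow_add_one ht.ne']; congr 1; ring
  have haM : ∀ x : ℝ, 3 * d + (2 * m + 5) * x ^ (2 * m + 2) ≤ a x - ε * α ^ 2 / 4 := by
    intro x
    have : 0 ≤ (p - 1) * v := by positivity
    have : 0 < ε * α := by positivity
    simp only [ha, evenProfile, hμ]
    linarith
  have heε : ∀ x : ℝ, 0 < 3 * d + (2 * m + 5) * x ^ (2 * m + 2) := by
    intro x
    have := hz x
    positivity
  refine ⟨selfSimilar (-α) fun _ => ε, selfSimilar (-α - 2) a, selfSimilar (-α - 2) b,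
    selfSimilar (-α - 2) w, selfSimilar (-α - 2) j,
    smoothOnCone1_selfSimilar _ contDiff_const,
    smoothOnCone1_selfSimilar _ (contDiff_evenProfile ..),
    smoothOnCone1_selfSimilar _ (contDiff_evenProfile ..),
    smoothOnCone1_selfSimilar _ (contDiff_evenProfile ..),
    smoothOnCone1_selfSimilar _ (contDiff_oddProfile ..),
    isEvenR_selfSimilar _ fun _ => rfl,
    isEvenR_selfSimilar _ (evenProfile_neg _ _ _ _ _),
    isEvenR_selfSimilar _ (evenProfile_neg _ _ _ _ _),
    isEvenR_selfSimilar _ (evenProfile_neg _ _ _ _ _),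
    isOddR_selfSimilar _ (oddProfile_neg _ _ _),
    homogOrder_selfSimilar _ _, homogOrder_selfSimilar _ _, homogOrder_selfSimilar _ _,
    homogOrder_selfSimilar _ _, homogOrder_selfSimilar _ _, ?_, ?_, ?_, ?_, ?_, ?_, ?_⟩
  · have hbw : (fun q => selfSimilar (-α - 2) b q - selfSimilar (-α - 2) w q)
        = selfSimilar (-α - 2) (fun x => b x - w x) := by
      funext q; simp only [selfSimilar]; ring
    rw [hbw]
    intro t ht i hi
    interval_cases i
    · simp [selfSimilar, hb, hw, evenProfile]
    · have := pdr_selfSimilar (β := -α - 2) (q := (t, 0)) ht ((hdb _).fun_sub (hdw _))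
      simp [this]
  · intro q hq _
    rw [hD q hq.1, selfSimilar]
    have := Real.rpow_pos_of_pos hq.1 (-α - 2)
    have : 0 < (p + 1) * v := by positivity
    positivity
  · intro q hq hr
    have ht := hq.1
    rw [pdt_congr hD ht, htrace', pdt_selfSimilar ht (hasDerivAt_const _ _),
      pdt_selfSimilar ht (hasDerivAt_const _ _), pdt_selfSimilar ht (hda _),
      pdr_selfSimilar ht (hdj _)]
    have hE : 2 / q.2 * selfSimilar (-α - 2) j q = q.1 ^ (-α - 2 - 1) *
        (2 * (-((α + 2) * d) - (α + 4 + 2 * m) * (q.2 / q.1) ^ (2 * m + 2))) := by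
      have : q.1 ^ (-α - 2) = q.1 ^ (-α - 2 - 1) * q.1 := by
        rw [← Real.rpow_add_one ht.ne']; congr 1; ring
      rw [selfSimilar, this]
      simp only [hj, oddProfile, hpow3]
      field_simp
      ring
    rw [hE]
    generalize q.2 / q.1 = x
    generalize q.1 ^ (-α - 2 - 1) = s
    simp only [ha, evenProfile, hμ]
    ring
  · intro q hq hr
    have ht := hq.1
    rw [pdr_congr hD ht, htrace', pdr_selfSimilar ht (hasDerivAt_const _ _),
      pdr_selfSimilar ht (hasDerivAt_const _ _), pdt_selfSimilar ht (hdj _),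
      pdr_selfSimilar ht (hdb _)]
    have hE : 2 / q.2 * (selfSimilar (-α - 2) b q - selfSimilar (-α - 2) w q)
        = q.1 ^ (-α - 2 - 1) * (3 * d * κ₃ * (q.2 / q.1)
          - 2 * (m + 1) * (q.2 / q.1) ^ (2 * m + 1) + 3 * κ * (q.2 / q.1) ^ (2 * m + 3)) := by
      have : q.1 ^ (-α - 2) = q.1 ^ (-α - 2 - 1) * q.1 := by
        rw [← Real.rpow_add_one ht.ne']; congr 1; ring
      have hx0 : q.2 = q.2 / q.1 * q.1 := by field_simp
      have hx1 : q.2 / q.1 ≠ 0 := div_ne_zero hr ht.ne'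
      rw [selfSimilar, selfSimilar, this]
      generalize q.2 / q.1 = x at hx0 hx1
      rw [hx0]
      generalize q.1 ^ (-α - 2 - 1) = s
      simp only [hb, hw, evenProfile]
      field_simp
      ring
    rw [hE]
    generalize q.2 / q.1 = x
    generalize q.1 ^ (-α - 2 - 1) = s
    simp only [hj, oddProfile]
    rw [hκ₃]
    linear_combination (-(p + 1) * s * x ^ (2 * m + 3)) * hκe
  · intro q hq
    refine mul_pos (Real.rpow_pos_of_pos hq.1 _) ?_
    have := angular_profile_pos hα0 hα1 hL hLα hd0 hρd (hx q hq) (hz _) (hzd _)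
    simp only [hw, evenProfile, hpow4, hκ₃, hκ]
    linarith
  · intro q hq _
    have ht := hq.1
    have hs : 0 < q.1 ^ (-α - 2) := Real.rpow_pos_of_pos ht _
    have hmain := momentum_sq_lt hα0 hα1 hL hd0 hρd (hx q hq) (hz (q.2 / q.1))
    have hpd : (!![selfSimilar (-α) (fun _ => ε) q,
        1 / 2 * pdt (selfSimilar (-α) fun _ => ε) q, 0;
        1 / 2 * pdt (selfSimilar (-α) fun _ => ε) q, selfSimilar (-α - 2) a q,
          selfSimilar (-α - 2) j q;
        0, selfSimilar (-α - 2) j q, selfSimilar (-α - 2) b q]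
        : Matrix (Fin 3) (Fin 3) ℝ).PosDef := by
      rw [hM q ht]
      refine posDef_mat3_of
        (D := q.1 ^ (-α - 2) * (3 * d + (2 * m + 5) * (q.2 / q.1) ^ (2 * m + 2))) ?_ ?_ ?_ ?_
      · exact mul_pos (Real.rpow_pos_of_pos ht _) hε0
      · exact mul_pos hs (heε _)
      · simp only [selfSimilar, hs2 _ ht, hs1 _ ht]
        have h1 : 0 ≤ (q.1 ^ (-α - 2)) ^ 2 * q.1 ^ 2 * ε := by positivity
        have := mul_le_mul_of_nonneg_left (haM (q.2 / q.1)) h1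
        linarith
      · have h1 := mul_lt_mul_of_pos_left hmain (pow_pos hs 2)
        simp only [selfSimilar, hj, hb, oddProfile, evenProfile, hpow4, hpow3, hκ₃, hκ]
        linarith
    simpa [mat3, hMr q ht] using hpd
  · intro q hq _
    have ht := hq.1
    have hs : 0 < q.1 ^ (-α - 2) := Real.rpow_pos_of_pos ht _
    rw [mat2, hM q ht]
    refine posDef_mat2_of (mul_pos (Real.rpow_pos_of_pos ht _) hε0) ?_
    simp only [selfSimilar, hs2 _ ht, hs1 _ ht]
    have h1 : 0 < (q.1 ^ (-α - 2)) ^ 2 * q.1 ^ 2 * ε := by positivity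
    have := mul_lt_mul_of_pos_left ((heε (q.2 / q.1)).trans_le (haM (q.2 / q.1))) h1
    linarith
end
end

section
/- Let p > 5 and K ≥ 1 be real numbers. Then there exist constants A₀ ≥ 1, δ₀ > 0 and C > 0, depending only on p and K, such that the following holds for every A ≥ A₀ and every 0 < δ ≤ δ₀. Let e₊ : Γ₁ˡ → ℝ be smooth on the left half-cone Γ₁ˡ := {(t,r) : t > 0, −t ≤ r ≤ 0} and homogeneous of order −4/(p−1) (i.e., e₊(λt,λr) = λ^{−4/(p−1)} e₊(t,r) for λ > 0), satisfying: (i) e₊(1,r) = (1+r)^{−4/(p−1)} for −1+δ ≤ r ≤ 0; (ii) e₊(1,r) ≥ (1+r)^{−4/(p−1)} for −1+δ/2 ≤ r ≤ −1+δ; (iii) ∫_{−1+δ/2}^{−1+δ} e₊(1,r) dr ≥ A δ^{1−4/(p−1)}; (iv) K^{−1} δ^{−4/(p−1)} ≤ e₊(1,r) ≤ K A δ^{−4/(p−1)} and |d/dr e₊(1,r)| ≤ K A δ^{−(p+3)/(p−1)} for −1 ≤ r ≤ −1+δ. Define V(t,r) := (1/(2|r|^{p−1})) ∫_r^0 |s|^{p−1}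 ((∂_t − ∂_r)e₊)(t−r+s, s) ds for −t ≤ r < 0. Then 0 ≤ V(t,r) ≤ C A t^{−4/(p−1)} δ^{(p−5)/(p−1)} whenever −t ≤ r ≤ −(1−δ)t. -/
open Real MeasureTheory

noncomputable section

/-- The left half `Γ₁ˡ = {(t,r) : t > 0, -t ≤ r ≤ 0}` of the `1+1`-dimensional cone. -/
def ConeL : Set (ℝ × ℝ) := {q | 0 < q.1 ∧ -q.1 ≤ q.2 ∧ q.2 ≤ 0}

/-- The potential energy density
`V(t,r) = (1/(2|r|^{p-1})) ∫_r^0 |s|^{p-1} ((∂_t - ∂_r) e₊)(t-r+s, s) ds`. -/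
def Vfun (p : ℝ) (ep : ℝ × ℝ → ℝ) (t r : ℝ) : ℝ :=
  (1 / (2 * |r| ^ (p - 1))) *
    ∫ s in r..(0 : ℝ), |s| ^ (p - 1) * (pdt ep (t - r + s, s) - pdr ep (t - r + s, s))


/-- The weight `(1 - z)^{p-1} (2 - z)^{a-p}` produced by writing the integral along an outgoing
ray in the self-similar variable `z = 1 + r / t`. -/
def rayWeight (p a z : ℝ) : ℝ := (1 - z) ^ (p - 1) * (2 - z) ^ (a - p)

theorem hasDerivAt_rayWeight (p a : ℝ) {z : ℝ} (hz : z < 1) :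
    HasDerivAt (rayWeight p a)
      (rayWeight p a z * ((p - a) / (2 - z) - (p - 1) / (1 - z))) z := by
  have h1 : (0 : ℝ) < 1 - z := by linarith
  have h2 : (0 : ℝ) < 2 - z := by linarith
  have d1 := ((hasDerivAt_id z).const_sub 1).rpow_const (p := p - 1) (Or.inl h1.ne')
  have d2 := ((hasDerivAt_id z).const_sub 2).rpow_const (p := a - p) (Or.inl h2.ne')
  refine (d1.mul d2).congr_deriv ?_
  simp only [id, rayWeight, rpow_sub_one h1.ne', rpow_sub_one h2.ne']
  field_simp
  ring

theorem rayWeight_nonneg (p a : ℝ) {z : ℝ} (hz : z ≤ 1) : 0 ≤ rayWeight p a z :=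
  mul_nonneg (rpow_nonneg (by linarith) _) (rpow_nonneg (by linarith) _)

theorem rayWeight_le_one {p a z : ℝ} (hp : 1 ≤ p) (ha : a ≤ p) (hz0 : 0 ≤ z) (hz : z ≤ 1) :
    rayWeight p a z ≤ 1 :=
  mul_le_one₀ (rpow_le_one (by linarith) (by linarith) (by linarith))
    (rpow_nonneg (by linarith) _) (rpow_le_one_of_one_le_of_nonpos (by linarith) (by linarith))

theorem le_rayWeight {p a z : ℝ} (hp : 1 ≤ p) (ha : a ≤ p) (hz0 : 0 ≤ z) (hz : z ≤ 1 / 2) :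
    (1 / 2) ^ (p - 1) * 2 ^ (a - p) ≤ rayWeight p a z :=
  mul_le_mul (rpow_le_rpow (by norm_num) (by linarith) (by linarith))
    (rpow_le_rpow_of_nonpos (by linarith) (by linarith) (by linarith))
    (by positivity) (rpow_nonneg (by linarith) _)

/-- The coefficient `(z φ)' - a φ`, for `φ = rayWeight p a`, which multiplies the energy profile
after an integration by parts. -/
def rayCoeff (p a z : ℝ) : ℝ :=
  rayWeight p a z * (1 - a + z * ((p - a) / (2 - z) - (p - 1) / (1 - z)))

theorem continuousOn_rayWeight (p a : ℝ) : ContinuousOn (rayWeight p a) (Set.Iio 1) :=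
  fun _ hz => (hasDerivAt_rayWeight p a hz).continuousAt.continuousWithinAt

theorem continuousOn_rayCoeff (p a : ℝ) : ContinuousOn (rayCoeff p a) (Set.Iio 1) := by
  refine (continuousOn_rayWeight p a).mul (continuousOn_const.add (continuousOn_id.mul
    ((continuousOn_const.div (by fun_prop) ?_).sub (continuousOn_const.div (by fun_prop) ?_)))) <;>
  · intro z hz
    have : z < 1 := hz
    linarith

theorem mul_rayWeight_le_rayCoeff {p a δ z : ℝ} (hp : 5 < p) (ha : 0 < a) (ha1 : a < 1)
    (hδ : δ ≤ (1 - a) / (4 * (p - 1))) (hz0 : 0 ≤ z) (hz : z ≤ δ) :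
    (1 - a) / 2 * rayWeight p a z ≤ rayCoeff p a z := by
  have hz' : z * (4 * (p - 1)) ≤ 1 - a := (le_div_iff₀ (by linarith)).1 (hz.trans hδ)
  have hz2 : z ≤ 1 / 2 := by nlinarith
  have h1 : 0 ≤ z * ((p - a) / (2 - z)) :=
    mul_nonneg hz0 (div_nonneg (by linarith) (by linarith))
  have h2 : (p - 1) / (1 - z) ≤ 2 * (p - 1) := by
    rw [div_le_iff₀ (by linarith)]
    nlinarith
  have h3 := mul_le_mul_of_nonneg_left h2 hz0
  rw [rayCoeff, mul_comm]
  refine mul_le_mul_of_nonneg_left ?_ (rayWeight_nonneg p a (by linarith))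
  linarith

/-- Integration by parts against `rayWeight`. -/
theorem integral_rayWeight_mul {p a x y : ℝ} {f f' : ℝ → ℝ} (hxy : x ≤ y) (hy : y < 1)
    (hf : ∀ z ∈ Set.Icc x y, HasDerivAt f (f' z) z) (hf' : ContinuousOn f' (Set.Icc x y)) :
    ∫ z in x..y, rayWeight p a z * (a * f z + z * f' z) =
      rayWeight p a y * (y * f y) - rayWeight p a x * (x * f x) -
        ∫ z in x..y, f z * rayCoeff p a z := by
  have hsub : Set.Icc x y ⊆ Set.Iio 1 := fun z hz => hz.2.trans_lt hy
  have hw := (continuousOn_rayWeight p a).mono hsub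
  have hc := (continuousOn_rayCoeff p a).mono hsub
  have hfc : ContinuousOn f (Set.Icc x y) :=
    fun z hz => (hf z hz).continuousAt.continuousWithinAt
  have i1 : IntervalIntegrable (fun z => rayWeight p a z * (a * f z + z * f' z)) volume x y := by
    refine ContinuousOn.intervalIntegrable ?_
    rw [Set.uIcc_of_le hxy]
    fun_prop
  have i2 : IntervalIntegrable (fun z => f z * rayCoeff p a z) volume x y := by
    refine ContinuousOn.intervalIntegrable ?_
    rw [Set.uIcc_of_le hxy]
    fun_prop
  have key := intervalIntegral.integral_eq_sub_of_hasDerivAt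
    (f := fun z => rayWeight p a z * (z * f z))
    (f' := fun z => rayWeight p a z * (a * f z + z * f' z) + f z * rayCoeff p a z)
    (a := x) (b := y) (fun z hz => by
      rw [Set.uIcc_of_le hxy] at hz
      refine ((hasDerivAt_rayWeight p a (hsub hz)).mul
        ((hasDerivAt_id z).mul (hf z hz))).congr_deriv ?_
      simp only [rayCoeff, id, Pi.mul_apply]
      ring) (i1.add i2)
  rw [intervalIntegral.integral_add i1 i2] at key
  linarith

/-- If `f` lies above `z^{-a}` with equality at the right end, the weighted integral of the Euler
operator of `f` is nonpositive. -/
theorem integral_rayWeight_nonpos_of_le {p a δ x : ℝ} {f f' : ℝ → ℝ} (hp : 5 < p) (ha : 0 < a)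
    (ha1 : a < 1) (hδ : δ ≤ (1 - a) / (4 * (p - 1))) (hδ1 : δ < 1) (hx : 0 < x) (hxδ : x ≤ δ)
    (hf : ∀ z ∈ Set.Icc x δ, HasDerivAt f (f' z) z) (hf' : ContinuousOn f' (Set.Icc x δ))
    (hfδ : f δ = δ ^ (-a)) (hle : ∀ z ∈ Set.Icc x δ, z ^ (-a) ≤ f z) :
    ∫ z in x..δ, rayWeight p a z * (a * f z + z * f' z) ≤ 0 := by
  have hpos : ∀ z ∈ Set.Icc x δ, 0 < z := fun z hz => hx.trans_le hz.1
  have hd : ∀ z ∈ Set.Icc x δ, HasDerivAt (fun z => f z - z ^ (-a))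
      (f' z - (-a) * z ^ (-a - 1)) z := fun z hz =>
    (hf z hz).sub (hasDerivAt_rpow_const (Or.inl (hpos z hz).ne'))
  have hc : ContinuousOn (fun z : ℝ => f' z - (-a) * z ^ (-a - 1)) (Set.Icc x δ) :=
    hf'.sub (continuousOn_const.mul (continuousOn_id.rpow_const
      fun z hz => Or.inl (hpos z hz).ne'))
  have key := integral_rayWeight_mul (p := p) (a := a) hxδ hδ1 hd hc
  have hcongr : ∫ z in x..δ, rayWeight p a z * (a * f z + z * f' z) =
      ∫ z in x..δ, rayWeight p a z *
        (a * (f z - z ^ (-a)) + z * (f' z - (-a) * z ^ (-a - 1))) := by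
    refine intervalIntegral.integral_congr fun z hz => ?_
    rw [Set.uIcc_of_le hxδ] at hz
    have h0 := (hpos z hz).ne'
    simp only [rpow_sub_one h0]
    field_simp
    ring
  rw [hcongr, key, hfδ]
  have h1 : 0 ≤ rayWeight p a x * (x * (f x - x ^ (-a))) :=
    mul_nonneg (rayWeight_nonneg p a (by linarith))
      (mul_nonneg hx.le (sub_nonneg.2 (hle x ⟨le_rfl, hxδ⟩)))
  have h2 : 0 ≤ ∫ z in x..δ, (f z - z ^ (-a)) * rayCoeff p a z := by
    refine intervalIntegral.integral_nonneg hxδ fun z hz => ?_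
    refine mul_nonneg (sub_nonneg.2 (hle z hz)) (le_trans ?_
      (mul_rayWeight_le_rayCoeff hp ha ha1 hδ (hpos z hz).le hz.2))
    exact mul_nonneg (by linarith) (rayWeight_nonneg p a (hz.2.trans hδ1.le))
  simp only [sub_self, mul_zero]
  linarith

/-- If `f` is nonnegative with a large enough mass on `[δ/2, δ]`, the weighted integral of the
Euler operator of `f` is nonpositive. -/
theorem integral_rayWeight_nonpos_of_mass {p a δ x A : ℝ} {f f' : ℝ → ℝ} (hp : 5 < p)
    (ha : 0 < a) (ha1 : a < 1) (hδ : δ ≤ (1 - a) / (4 * (p - 1))) (hδ0 : 0 < δ) (hδ1 : δ ≤ 1 / 2)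
    (hx : 0 ≤ x) (hxδ : x ≤ δ / 2)
    (hA : 1 ≤ (1 - a) / 2 * ((1 / 2) ^ (p - 1) * 2 ^ (a - p)) * A)
    (hf : ∀ z ∈ Set.Icc 0 δ, HasDerivAt f (f' z) z) (hf' : ContinuousOn f' (Set.Icc 0 δ))
    (hfδ : f δ = δ ^ (-a)) (hf0 : ∀ z ∈ Set.Icc 0 δ, 0 ≤ f z)
    (hmass : A * δ ^ (1 - a) ≤ ∫ z in (δ / 2)..δ, f z) :
    ∫ z in x..δ, rayWeight p a z * (a * f z + z * f' z) ≤ 0 := by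
  have hx1 : x ≤ δ := by linarith
  have hsub : Set.Icc x δ ⊆ Set.Icc 0 δ := Set.Icc_subset_Icc_left hx
  have hsub' : Set.Icc (δ / 2) δ ⊆ Set.Icc 0 δ := Set.Icc_subset_Icc_left (by linarith)
  have hlt : Set.Icc 0 δ ⊆ Set.Iio 1 := fun z hz => by
    have := hz.2
    simp only [Set.mem_Iio]
    linarith
  set c : ℝ := (1 / 2) ^ (p - 1) * 2 ^ (a - p)
  have hcoeff : ∀ z ∈ Set.Icc 0 δ, (1 - a) / 2 * c ≤ rayCoeff p a z := fun z hz =>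
    (mul_le_mul_of_nonneg_left (le_rayWeight (by linarith) (by linarith) hz.1
      (hz.2.trans hδ1)) (by linarith)).trans (mul_rayWeight_le_rayCoeff hp ha ha1 hδ hz.1 hz.2)
  have hc0 : 0 ≤ (1 - a) / 2 * c := mul_nonneg (by linarith) (by positivity)
  have hfc : ContinuousOn f (Set.Icc 0 δ) :=
    fun z hz => (hf z hz).continuousAt.continuousWithinAt
  have hcont : ContinuousOn (fun z => f z * rayCoeff p a z) (Set.Icc 0 δ) :=
    hfc.mul ((continuousOn_rayCoeff p a).mono hlt)
  have hint : ∀ y ∈ Set.Icc 0 δ, ∀ y' ∈ Set.Icc 0 δ,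
      IntervalIntegrable (fun z => f z * rayCoeff p a z) volume y y' := fun y hy y' hy' =>
    (hcont.mono (Set.uIcc_subset_Icc hy hy')).intervalIntegrable
  have hhalf : δ / 2 ∈ Set.Icc 0 δ := ⟨by linarith, by linarith⟩
  have hend : δ ∈ Set.Icc 0 δ := ⟨hδ0.le, le_rfl⟩
  rw [integral_rayWeight_mul hx1 (hlt hend) (fun z hz => hf z (hsub hz)) (hf'.mono hsub),
    ← intervalIntegral.integral_add_adjacent_intervals (hint x ⟨hx, hx1⟩ _ hhalf)
      (hint _ hhalf _ hend)]
  have h1 : 0 ≤ rayWeight p a x * (x * f x) :=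
    mul_nonneg (rayWeight_nonneg p a (by linarith)) (mul_nonneg hx (hf0 x ⟨hx, hx1⟩))
  have h2 : 0 ≤ ∫ z in x..(δ / 2), f z * rayCoeff p a z := by
    refine intervalIntegral.integral_nonneg hxδ fun z hz => ?_
    have hz' : z ∈ Set.Icc 0 δ := ⟨hx.trans hz.1, by linarith [hz.2]⟩
    exact mul_nonneg (hf0 z hz') (hc0.trans (hcoeff z hz'))
  have h3 : (1 - a) / 2 * c * ∫ z in (δ / 2)..δ, f z ≤
      ∫ z in (δ / 2)..δ, f z * rayCoeff p a z := by
    rw [← intervalIntegral.integral_const_mul]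
    refine intervalIntegral.integral_mono_on (by linarith) ?_ (hint _ hhalf _ hend)
      fun z hz => ?_
    · exact ((hfc.mono (Set.uIcc_subset_Icc hhalf hend)).intervalIntegrable).const_mul _
    · rw [mul_comm]
      exact mul_le_mul_of_nonneg_left (hcoeff z (hsub' hz)) (hf0 z (hsub' hz))
  have h4 : rayWeight p a δ * (δ * f δ) ≤ δ ^ (1 - a) := by
    have : δ * f δ = δ ^ (1 - a) := by
      rw [hfδ, sub_eq_add_neg, rpow_add hδ0, rpow_one]
    rw [this]
    exact mul_le_of_le_one_left (by positivity)
      (rayWeight_le_one (by linarith) (by linarith) hδ0.le (by linarith))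
  have h5 : δ ^ (1 - a) ≤ (1 - a) / 2 * c * ∫ z in (δ / 2)..δ, f z := by
    refine le_trans ?_ (mul_le_mul_of_nonneg_left hmass hc0)
    rw [← mul_assoc]
    exact le_mul_of_one_le_left (by positivity) hA
  linarith

/-- Upper bound for the weighted integral of the Euler operator. -/
theorem neg_integral_rayWeight_le {p a δ x M : ℝ} {f f' : ℝ → ℝ} (hp : 1 ≤ p) (hap : a ≤ p)
    (hx : 0 ≤ x) (hxδ : x ≤ δ) (hδ1 : δ ≤ 1)
    (hM : ∀ z ∈ Set.Icc x δ, |a * f z + z * f' z| ≤ M) :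
    -∫ z in x..δ, rayWeight p a z * (a * f z + z * f' z) ≤ M * δ := by
  have hM0 : 0 ≤ M := (abs_nonneg _).trans (hM x ⟨le_rfl, hxδ⟩)
  have h := intervalIntegral.norm_integral_le_of_norm_le_const (a := x) (b := δ) (C := M)
    (f := fun z => rayWeight p a z * (a * f z + z * f' z)) fun z hz => by
      rw [Set.uIoc_of_le hxδ] at hz
      have hz0 : 0 ≤ z := hx.trans hz.1.le
      have hz1 : z ≤ 1 := hz.2.trans hδ1
      rw [norm_mul, norm_eq_abs, norm_eq_abs, abs_of_nonneg (rayWeight_nonneg p a hz1)]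
      exact (mul_le_of_le_one_left (abs_nonneg _) (rayWeight_le_one hp hap hz0 hz1)).trans
        (hM z ⟨hz.1.le, hz.2⟩)
  refine (neg_le_abs _).trans (h.trans ?_)
  rw [abs_of_nonneg (by linarith)]
  exact mul_le_mul_of_nonneg_left (by linarith) hM0

/-- Homogeneity of order `-a` on the left half-cone. -/
def HomogeneousOnConeL (a : ℝ) (ep : ℝ × ℝ → ℝ) : Prop :=
  ∀ l : ℝ, 0 < l → ∀ q ∈ ConeL, ep (l • q) = l ^ (-a) * ep q

theorem hasDerivAt_slice {ep : ℝ × ℝ → ℝ} {t r : ℝ} (h : DifferentiableAt ℝ ep (t, r)) :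
    HasDerivAt (fun x => ep (t, x)) (pdr ep (t, r)) r :=
  h.hasFDerivAt.comp_hasDerivAt r ((hasDerivAt_const r t).prodMk (hasDerivAt_id r))

/-- Euler's identity. -/
theorem HomogeneousOnConeL.euler {a : ℝ} {ep : ℝ × ℝ → ℝ} (hom : HomogeneousOnConeL a ep)
    {t r : ℝ} (hq : (t, r) ∈ ConeL) (h : DifferentiableAt ℝ ep (t, r)) :
    t * pdt ep (t, r) + r * pdr ep (t, r) = -a * ep (t, r) := by
  have h1 : HasDerivAt (fun l : ℝ => ep (l • (t, r))) (fderiv ℝ ep (t, r) (t, r)) 1 := by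
    have hs : HasDerivAt (fun l : ℝ => l • (t, r)) (t, r) 1 := by
      simpa using (hasDerivAt_id (1 : ℝ)).smul_const (t, r)
    have h' : HasFDerivAt ep (fderiv ℝ ep (t, r)) ((1 : ℝ) • (t, r)) := by
      simpa using h.hasFDerivAt
    exact h'.comp_hasDerivAt 1 hs
  have h2 : HasDerivAt (fun l : ℝ => ep (l • (t, r))) (-a * ep (t, r)) 1 := by
    have h3 : HasDerivAt (fun l : ℝ => l ^ (-a) * ep (t, r)) (-a * ep (t, r)) 1 := by
      simpa using (hasDerivAt_rpow_const (x := 1) (p := -a) (Or.inl one_ne_zero)).mul_const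
        (ep (t, r))
    refine h3.congr_of_eventuallyEq ?_
    filter_upwards [lt_mem_nhds (zero_lt_one' ℝ)] with l hl using hom l hl _ hq
  rw [← h1.unique h2, pdt, pdr, ← smul_eq_mul, ← smul_eq_mul, ← map_smul, ← map_smul, ← map_add]
  simp

theorem HomogeneousOnConeL.eq_rpow_mul {a : ℝ} {ep : ℝ × ℝ → ℝ} (hom : HomogeneousOnConeL a ep)
    {t r : ℝ} (hq : (t, r) ∈ ConeL) : ep (t, r) = t ^ (-a) * ep (1, r / t) := by
  obtain ⟨ht, h1, h2⟩ := hq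
  simp only at ht h1 h2
  rw [← hom t ht (1, r / t)]
  · simp [mul_div_cancel₀ r ht.ne']
  · refine ⟨one_pos, ?_, div_nonpos_of_nonpos_of_nonneg h2 ht.le⟩
    rw [le_div_iff₀ ht]
    linarith

theorem HomogeneousOnConeL.pdr_eq {a : ℝ} {ep : ℝ × ℝ → ℝ} (hom : HomogeneousOnConeL a ep)
    (hd : ∀ q ∈ ConeL, DifferentiableAt ℝ ep q) {t r : ℝ} (hq : (t, r) ∈ ConeL) :
    pdr ep (t, r) = t ^ (-a - 1) * pdr ep (1, r / t) := by
  obtain ⟨ht, h1, h2⟩ := id hq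
  simp only at ht h1 h2
  have hq' : (1, r / t) ∈ ConeL := by
    refine ⟨one_pos, ?_, div_nonpos_of_nonpos_of_nonneg h2 ht.le⟩
    rw [le_div_iff₀ ht]
    linarith
  have d1 := (hasDerivAt_slice (hd _ hq)).hasDerivWithinAt (s := Set.Icc (-t) 0)
  have d2 : HasDerivWithinAt (fun x => t ^ (-a) * ep (1, x / t))
      (t ^ (-a) * (pdr ep (1, r / t) * (1 / t))) (Set.Icc (-t) 0) r :=
    (((hasDerivAt_slice (hd _ hq')).comp r
      ((hasDerivAt_id r).div_const t)).const_mul _).hasDerivWithinAt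
  have d3 := d2.congr (f₁ := fun x => ep (t, x))
    (fun x hx => hom.eq_rpow_mul ⟨ht, hx.1, hx.2⟩) (hom.eq_rpow_mul hq)
  rw [(uniqueDiffOn_Icc (show -t < 0 by linarith) r ⟨h1, h2⟩).eq_deriv _ d1 d3,
    rpow_sub_one ht.ne']
  ring

/-- The incoming null derivative of a homogeneous function in terms of its profile. -/
theorem HomogeneousOnConeL.pdt_sub_pdr {a : ℝ} {ep : ℝ × ℝ → ℝ} (hom : HomogeneousOnConeL a ep)
    (hd : ∀ q ∈ ConeL, DifferentiableAt ℝ ep q) {t r : ℝ} (hq : (t, r) ∈ ConeL) :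
    pdt ep (t, r) - pdr ep (t, r) =
      -(t ^ (-a - 1) * (a * ep (1, r / t) + (1 + r / t) * pdr ep (1, r / t))) := by
  have ht : 0 < t := hq.1
  have he := hom.euler hq (hd _ hq)
  rw [hom.eq_rpow_mul hq] at he
  have h1 : t ^ (-a) = t * t ^ (-a - 1) := by rw [rpow_sub_one ht.ne', mul_div_cancel₀ _ ht.ne']
  rw [h1, hom.pdr_eq hd hq] at he
  rw [hom.pdr_eq hd hq]
  have h2 : pdt ep (t, r) = -a * t ^ (-a - 1) * ep (1, r / t) -
      r / t * (t ^ (-a - 1) * pdr ep (1, r / t)) := by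
    field_simp
    linear_combination he
  rw [h2]
  ring

theorem continuousOn_pdt_sub_pdr {ep : ℝ × ℝ → ℝ} {Ω : Set (ℝ × ℝ)} (hΩ : IsOpen Ω)
    (hC : ContDiffOn ℝ (⊤ : ℕ∞) ep Ω) :
    ContinuousOn (fun q => pdt ep q - pdr ep q) Ω := by
  have h := hC.continuousOn_fderiv_of_isOpen hΩ (by simp)
  exact (h.clm_apply continuousOn_const).sub (h.clm_apply continuousOn_const)

/-- The integrand of `Vfun` along the ray `t - r = u`. -/
def rayIntegrand (p : ℝ) (ep : ℝ × ℝ → ℝ) (u s : ℝ) : ℝ :=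
  |s| ^ (p - 1) * (pdt ep (u + s, s) - pdr ep (u + s, s))

theorem mem_coneL_of_ray {u s : ℝ} (hu : 0 < u) (h1 : -(u / 2) ≤ s) (h2 : s ≤ 0) :
    (u + s, s) ∈ ConeL :=
  ⟨by simp only; linarith, by simp only; linarith, h2⟩

theorem continuousOn_rayIntegrand {p u : ℝ} (hp : 1 < p) (hu : 0 < u) {ep : ℝ × ℝ → ℝ}
    {Ω : Set (ℝ × ℝ)} (hΩ : IsOpen Ω) (hsub : ConeL ⊆ Ω) (hC : ContDiffOn ℝ (⊤ : ℕ∞) ep Ω) :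
    ContinuousOn (rayIntegrand p ep u) (Set.Icc (-(u / 2)) 0) := by
  have h := (continuousOn_pdt_sub_pdr hΩ hC).comp
    (f := fun s : ℝ => (u + s, s)) (s := Set.Icc (-(u / 2)) 0) (by fun_prop)
    fun s hs => hsub (mem_coneL_of_ray hu hs.1 hs.2)
  exact (continuousOn_id.abs.rpow_const fun s _ => Or.inr (by linarith)).mul h

/-- The point on the ray `t - r = u` with `1 + r / t = z`. -/
def rayPoint (u z : ℝ) : ℝ := -(u * (1 - z) / (2 - z))

theorem hasDerivAt_rayPoint (u : ℝ) {z : ℝ} (hz : z ≤ 1) :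
    HasDerivAt (rayPoint u) (u / (2 - z) ^ 2) z := by
  have h2 : 2 - z ≠ 0 := by linarith
  refine (((((hasDerivAt_id z).const_sub 1).const_mul u).div
    ((hasDerivAt_id z).const_sub 2) h2).neg).congr_deriv ?_
  simp only [id]
  field_simp
  ring

theorem rayPoint_nonpos {u z : ℝ} (hu : 0 < u) (hz : z ≤ 1) : rayPoint u z ≤ 0 :=
  neg_nonpos.2 (div_nonneg (mul_nonneg hu.le (by linarith)) (by linarith))

theorem neg_half_le_rayPoint {u z : ℝ} (hu : 0 < u) (hz0 : 0 ≤ z) (hz : z ≤ 1) :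
    -(u / 2) ≤ rayPoint u z := by
  rw [rayPoint, neg_le_neg_iff, div_le_div_iff₀ (by linarith) two_pos]
  nlinarith

theorem rayPoint_self {t r : ℝ} (ht : 0 < t) (hr : r ≤ 0) : rayPoint (t - r) (1 + r / t) = r := by
  have h1 : 2 - (1 + r / t) = (t - r) / t := by field_simp; ring
  have h2 : t - r ≠ 0 := by linarith
  rw [rayPoint, h1]
  field_simp
  ring

theorem rayIntegrand_rayPoint {p a u z : ℝ} (hu : 0 < u) (hz0 : 0 ≤ z) (hz : z ≤ 1)
    {ep : ℝ × ℝ → ℝ} (hom : HomogeneousOnConeL a ep)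
    (hd : ∀ q ∈ ConeL, DifferentiableAt ℝ ep q) :
    rayIntegrand p ep u (rayPoint u z) * (u / (2 - z) ^ 2) =
      -u ^ (p - 1 - a) *
        (rayWeight p a z * (a * ep (1, z - 1) + z * pdr ep (1, z - 1))) := by
  have h2 : 0 < 2 - z := by linarith
  have h1 : 0 ≤ 1 - z := by linarith
  have ht : u + rayPoint u z = u / (2 - z) := by
    rw [rayPoint]
    field_simp
    ring
  have hx : rayPoint u z / (u / (2 - z)) = z - 1 := by
    rw [rayPoint]
    field_simp
    ring
  have hq : (u / (2 - z), rayPoint u z) ∈ ConeL := by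
    rw [← ht]
    exact mem_coneL_of_ray hu (neg_half_le_rayPoint hu hz0 hz) (rayPoint_nonpos hu hz)
  have hab : |rayPoint u z| = u * (1 - z) / (2 - z) := by
    rw [rayPoint, abs_neg, abs_of_nonneg (by positivity)]
  rw [rayIntegrand, ht, hom.pdt_sub_pdr hd hq, hx, hab, div_rpow (by positivity) h2.le,
    mul_rpow hu.le h1, div_rpow hu.le h2.le, rayWeight]
  have e1 : u ^ (p - 1 - a) = u ^ (p - 1) * u ^ (-a - 1) * u := by
    rw [← rpow_add hu, ← rpow_add_one hu.ne']
    congr 1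
    ring
  have e2 : (2 - z) ^ (a - p) * ((2 - z) ^ (p - 1) * (2 - z) ^ (-a - 1) * (2 - z) ^ 2) = 1 := by
    rw [← rpow_natCast, ← rpow_add h2, ← rpow_add h2, ← rpow_add h2]
    convert rpow_zero (2 - z) using 2
    push_cast
    ring
  have e3 : (2 - z) ^ (a - p) =
      ((2 - z) ^ (p - 1) * (2 - z) ^ (-a - 1) * (2 - z) ^ 2)⁻¹ := eq_inv_of_mul_eq_one_left e2
  rw [e1, e3, add_sub_cancel]
  field_simp

/-- `Vfun` in self-similar variables, when the profile is `z^{-a}` for `z ≥ δ`. -/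
theorem Vfun_eq {p a δ t r : ℝ} (hp : 1 < p) (hδ0 : 0 < δ) (hδ1 : δ < 1) {ep : ℝ × ℝ → ℝ}
    {Ω : Set (ℝ × ℝ)} (hΩ : IsOpen Ω) (hsub : ConeL ⊆ Ω) (hC : ContDiffOn ℝ (⊤ : ℕ∞) ep Ω)
    (hom : HomogeneousOnConeL a ep)
    (hprof : ∀ z ∈ Set.Icc δ 1, ep (1, z - 1) = z ^ (-a))
    (ht : 0 < t) (hr : -t ≤ r) (hr' : r ≤ -(1 - δ) * t) :
    Vfun p ep t r = (t - r) ^ (p - 1 - a) / (2 * |r| ^ (p - 1)) *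
      -∫ z in (1 + r / t)..δ,
        rayWeight p a z * (a * ep (1, z - 1) + z * pdr ep (1, z - 1)) := by
  have hd : ∀ q ∈ ConeL, DifferentiableAt ℝ ep q := fun q hq =>
    (hC.contDiffAt (hΩ.mem_nhds (hsub hq))).differentiableAt (by simp)
  have hr0 : r ≤ 0 := by nlinarith
  have hu : 0 < t - r := by linarith
  set u := t - r with hu'
  set x := 1 + r / t with hx'
  have hx0 : 0 ≤ x := by
    have : -1 ≤ r / t := by rw [le_div_iff₀ ht]; linarith
    linarith
  have hxδ : x ≤ δ := by
    have : r / t ≤ -(1 - δ) := by rwa [div_le_iff₀ ht]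
    linarith
  have hcont := continuousOn_rayIntegrand hp hu hΩ hsub hC
  have hmem : ∀ z ∈ Set.Icc (0 : ℝ) 1, rayPoint u z ∈ Set.Icc (-(u / 2)) 0 := fun z hz =>
    ⟨neg_half_le_rayPoint hu hz.1 hz.2, rayPoint_nonpos hu hz.2⟩
  have hsubst : ∀ y ∈ Set.Icc (0 : ℝ) 1, ∀ y' ∈ Set.Icc (0 : ℝ) 1,
      ∫ s in (rayPoint u y)..(rayPoint u y'), rayIntegrand p ep u s =
        -u ^ (p - 1 - a) * ∫ z in y..y',
          rayWeight p a z * (a * ep (1, z - 1) + z * pdr ep (1, z - 1)) := by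
    intro y hy y' hy'
    have hI : Set.uIcc y y' ⊆ Set.Icc 0 1 := Set.uIcc_subset_Icc hy hy'
    rw [← intervalIntegral.integral_const_mul,
      ← intervalIntegral.integral_comp_mul_deriv' (f' := fun z => u / (2 - z) ^ 2)
        (fun z hz => hasDerivAt_rayPoint u (hI hz).2) ?_
        (hcont.mono (Set.image_subset_iff.2 fun z hz => hmem z (hI hz)))]
    · exact intervalIntegral.integral_congr fun z hz =>
        rayIntegrand_rayPoint hu (hI hz).1 (hI hz).2 hom hd
    · refine continuousOn_const.div (by fun_prop) fun z hz => ?_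
      have := (hI hz).2
      exact pow_ne_zero 2 (by linarith)
  have hxI : x ∈ Set.Icc (0 : ℝ) 1 := ⟨hx0, by linarith⟩
  have hδI : δ ∈ Set.Icc (0 : ℝ) 1 := ⟨hδ0.le, hδ1.le⟩
  have h1I : (1 : ℝ) ∈ Set.Icc (0 : ℝ) 1 := ⟨zero_le_one, le_rfl⟩
  have hint : ∀ y ∈ Set.Icc (0 : ℝ) 1, ∀ y' ∈ Set.Icc (0 : ℝ) 1,
      IntervalIntegrable (rayIntegrand p ep u) volume (rayPoint u y) (rayPoint u y') :=
    fun y hy y' hy' => (hcont.mono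
      (Set.uIcc_subset_Icc (hmem y hy) (hmem y' hy'))).intervalIntegrable
  have hzero : ∫ z in δ..1,
      rayWeight p a z * (a * ep (1, z - 1) + z * pdr ep (1, z - 1)) = 0 := by
    rw [← intervalIntegral.integral_zero (a := δ) (b := 1) (μ := volume) (E := ℝ)]
    refine intervalIntegral.integral_congr fun z hz => ?_
    rw [Set.uIcc_of_le hδ1.le] at hz
    have hz0 : 0 < z := hδ0.trans_le hz.1
    have hq : (1, z - 1) ∈ ConeL :=
      ⟨one_pos, by simp only; linarith, by simp only; linarith [hz.2]⟩
    have d1 : HasDerivAt (fun z : ℝ => ep (1, z - 1)) (pdr ep (1, z - 1)) z :=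
      (hasDerivAt_slice (hd _ hq)).comp_sub_const z 1
    have d2 : HasDerivAt (fun z : ℝ => z ^ (-a)) (-a * z ^ (-a - 1)) z :=
      hasDerivAt_rpow_const (Or.inl hz0.ne')
    have d3 := (d2.hasDerivWithinAt (s := Set.Icc δ 1)).congr (f₁ := fun z : ℝ => ep (1, z - 1))
      hprof (hprof z hz)
    have e := (uniqueDiffOn_Icc hδ1 z hz).eq_deriv _ d1.hasDerivWithinAt d3
    simp only [e, hprof z hz, rpow_sub_one hz0.ne']
    field_simp
    ring
  have hV : ∫ s in r..(0 : ℝ), rayIntegrand p ep u s = -u ^ (p - 1 - a) *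
      ∫ z in x..δ, rayWeight p a z * (a * ep (1, z - 1) + z * pdr ep (1, z - 1)) := by
    have hrx : rayPoint u x = r := rayPoint_self ht hr0
    have h10 : rayPoint u 1 = 0 := by simp [rayPoint]
    have hadd := intervalIntegral.integral_add_adjacent_intervals (hint x hxI δ hδI)
      (hint δ hδI 1 h1I)
    rw [hsubst x hxI δ hδI, hsubst δ hδI 1 h1I, hzero, hrx, h10] at hadd
    rw [← hadd]
    ring
  simp only [rayIntegrand] at hV
  rw [Vfun, hV]
  ring

/-- Proposition 6.1 and the estimates (6.1)–(6.5).  Bounds on the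
potential energy density `V` constructed from the null energy `e₊` on the left
half-cone. -/
theorem stmt15 (p K : ℝ) (hp : 5 < p) (hK : 1 ≤ K) :
    ∃ A₀ : ℝ, 1 ≤ A₀ ∧ ∃ δ₀ : ℝ, 0 < δ₀ ∧ ∃ C : ℝ, 0 < C ∧
      ∀ A : ℝ, A₀ ≤ A → ∀ δ : ℝ, 0 < δ → δ ≤ δ₀ →
        ∀ ep : ℝ × ℝ → ℝ, ∀ Ω : Set (ℝ × ℝ), IsOpen Ω → ConeL ⊆ Ω →
          ContDiffOn ℝ (⊤ : ℕ∞) ep Ω →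
          -- homogeneity of order `-4/(p-1)`
          (∀ l : ℝ, 0 < l → ∀ q ∈ ConeL, ep (l • q) = l ^ (-(4 / (p - 1))) * ep q) →
          -- (i)
          (∀ r : ℝ, -1 + δ ≤ r → r ≤ 0 → ep (1, r) = (1 + r) ^ (-(4 / (p - 1)))) →
          -- (ii)
          (∀ r : ℝ, -1 + δ / 2 ≤ r → r ≤ -1 + δ →
            (1 + r) ^ (-(4 / (p - 1))) ≤ ep (1, r)) →
          -- (iii)
          A * δ ^ (1 - 4 / (p - 1)) ≤ (∫ r in (-1 + δ / 2)..(-1 + δ), ep (1, r)) →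
          -- (iv)
          (∀ r : ℝ, -1 ≤ r → r ≤ -1 + δ →
            K⁻¹ * δ ^ (-(4 / (p - 1))) ≤ ep (1, r) ∧
            ep (1, r) ≤ K * A * δ ^ (-(4 / (p - 1))) ∧
            |pdr ep (1, r)| ≤ K * A * δ ^ (-((p + 3) / (p - 1)))) →
          -- conclusion
          ∀ t r : ℝ, 0 < t → -t ≤ r → r ≤ -(1 - δ) * t →
            0 ≤ Vfun p ep t r ∧
            Vfun p ep t r ≤ C * A * t ^ (-(4 / (p - 1))) * δ ^ ((p - 5) / (p - 1)) := by
  set a : ℝ := 4 / (p - 1) with ha'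
  have hp1 : 0 < p - 1 := by linarith
  have ha : 0 < a := by positivity
  have ha1 : a < 1 := by rw [ha', div_lt_one hp1]; linarith
  have hexp : (p + 3) / (p - 1) = 1 + a := by rw [ha']; field_simp; ring
  have hexp' : (p - 5) / (p - 1) = 1 - a := by rw [ha']; field_simp; ring
  rw [hexp, hexp']
  have hc : 0 < (1 - a) / 2 * ((1 / 2) ^ (p - 1) * 2 ^ (a - p)) :=
    mul_pos (by linarith) (by positivity)
  refine ⟨1 + ((1 - a) / 2 * ((1 / 2) ^ (p - 1) * 2 ^ (a - p)))⁻¹,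
    le_add_of_nonneg_right (inv_nonneg.2 hc.le), (1 - a) / (4 * (p - 1)),
    div_pos (by linarith) (by linarith),
    2 ^ (p - 1 - a) * 2 ^ (p - 1) * K, by positivity, ?_⟩
  intro A hA δ hδ0 hδ ep Ω hΩ hsub hC hom hi hii hiii hiv t r ht hr hr'
  have hA1 : 1 ≤ (1 - a) / 2 * ((1 / 2) ^ (p - 1) * 2 ^ (a - p)) * A := by
    rw [← inv_le_iff_one_le_mul₀' hc]
    linarith
  have hA0 : 0 < A := by
    have := inv_pos.2 hc
    linarith
  have hδ1 : δ ≤ 1 / 2 := by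
    have := (le_div_iff₀ (by linarith)).1 hδ
    nlinarith
  have hd : ∀ q ∈ ConeL, DifferentiableAt ℝ ep q := fun q hq =>
    (hC.contDiffAt (hΩ.mem_nhds (hsub hq))).differentiableAt (by simp)
  have hmem : ∀ z ∈ Set.Icc (0 : ℝ) 1, (1, z - 1) ∈ ConeL := fun z hz =>
    ⟨one_pos, by simp only; linarith [hz.1], by simp only; linarith [hz.2]⟩
  have hI : Set.Icc 0 δ ⊆ Set.Icc 0 1 := Set.Icc_subset_Icc_right (by linarith)
  have hprof : ∀ z ∈ Set.Icc δ 1, ep (1, z - 1) = z ^ (-a) := fun z hz => by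
    rw [hi (z - 1) (by linarith [hz.1]) (by linarith [hz.2]), add_sub_cancel]
  have hiv' : ∀ z ∈ Set.Icc 0 δ, 0 ≤ ep (1, z - 1) ∧ ep (1, z - 1) ≤ K * A * δ ^ (-a) ∧
      |pdr ep (1, z - 1)| ≤ K * A * δ ^ (-(1 + a)) := fun z hz => by
    obtain ⟨h1, h2⟩ := hiv (z - 1) (by linarith [hz.1]) (by linarith [hz.2])
    exact ⟨le_trans (by positivity) h1, h2⟩
  have hderiv : ∀ z ∈ Set.Icc 0 δ,
      HasDerivAt (fun z : ℝ => ep (1, z - 1)) (pdr ep (1, z - 1)) z := fun z hz =>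
    (hasDerivAt_slice (hd _ (hmem z (hI hz)))).comp_sub_const z 1
  have hcont : ContinuousOn (fun z : ℝ => pdr ep (1, z - 1)) (Set.Icc 0 δ) :=
    ((hC.continuousOn_fderiv_of_isOpen hΩ (by simp)).clm_apply continuousOn_const).comp
      (f := fun z : ℝ => ((1 : ℝ), z - 1)) (by fun_prop) fun z hz => hsub (hmem z (hI hz))
  have hx0 : 0 ≤ 1 + r / t := by
    have : -1 ≤ r / t := by rw [le_div_iff₀ ht]; linarith
    linarith
  have hxδ : 1 + r / t ≤ δ := by
    have : r / t ≤ -(1 - δ) := by rwa [div_le_iff₀ ht]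
    linarith
  have hpδ : ep (1, δ - 1) = δ ^ (-a) := hprof δ ⟨le_rfl, by linarith⟩
  have hpre : 0 ≤ (t - r) ^ (p - 1 - a) / (2 * |r| ^ (p - 1)) :=
    div_nonneg (rpow_nonneg (by nlinarith) _) (by positivity)
  rw [Vfun_eq (by linarith) hδ0 (by linarith) hΩ hsub hC hom hprof ht hr hr']
  constructor
  · refine mul_nonneg hpre (neg_nonneg.2 ?_)
    rcases le_or_gt (1 + r / t) (δ / 2) with hx | hx
    · refine integral_rayWeight_nonpos_of_mass hp ha ha1 hδ hδ0 hδ1 hx0 hx hA1 hderiv hcont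
        hpδ (fun z hz => (hiv' z hz).1) ?_
      rw [intervalIntegral.integral_comp_sub_right (fun x => ep (1, x))]
      convert hiii using 2 <;> ring
    · have hs : Set.Icc (1 + r / t) δ ⊆ Set.Icc 0 δ := Set.Icc_subset_Icc_left hx0
      refine integral_rayWeight_nonpos_of_le hp ha ha1 hδ (by linarith) (by linarith) hxδ
        (fun z hz => hderiv z (hs hz)) (hcont.mono hs) hpδ fun z hz => ?_
      have := hii (z - 1) (by linarith [hz.1]) (by linarith [hz.2])
      rwa [add_sub_cancel] at this
  · have hM : ∀ z ∈ Set.Icc (1 + r / t) δ,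
        |a * ep (1, z - 1) + z * pdr ep (1, z - 1)| ≤ 2 * K * A * δ ^ (-a) := by
      intro z hz
      have hz0 : 0 ≤ z := hx0.trans hz.1
      obtain ⟨h1, h2, h3⟩ := hiv' z ⟨hz0, hz.2⟩
      have e1 : |a * ep (1, z - 1)| ≤ K * A * δ ^ (-a) := by
        rw [abs_mul, abs_of_pos ha, abs_of_nonneg h1]
        exact (mul_le_of_le_one_left h1 ha1.le).trans h2
      have e2 : |z * pdr ep (1, z - 1)| ≤ K * A * δ ^ (-a) := by
        rw [abs_mul, abs_of_nonneg hz0]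
        refine (mul_le_mul hz.2 h3 (abs_nonneg _) hδ0.le).trans_eq ?_
        have : δ ^ (-a) = δ * δ ^ (-(1 + a)) := by
          rw [mul_comm, ← rpow_add_one hδ0.ne']
          congr 1
          ring
        rw [this]
        ring
      linarith [abs_add_le (a * ep (1, z - 1)) (z * pdr ep (1, z - 1))]
    have hint := neg_integral_rayWeight_le (p := p) (by linarith) (by linarith) hx0 hxδ
      (by linarith) hM
    have hnum : (t - r) ^ (p - 1 - a) ≤ 2 ^ (p - 1 - a) * t ^ (p - 1 - a) := by
      rw [← mul_rpow two_pos.le ht.le]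
      exact rpow_le_rpow (by nlinarith) (by linarith) (by linarith)
    have hden : (t / 2) ^ (p - 1) ≤ |r| ^ (p - 1) := by
      refine rpow_le_rpow (by linarith) ?_ (by linarith)
      rw [abs_of_nonpos (by nlinarith)]
      nlinarith
    have hfac : (t - r) ^ (p - 1 - a) / (2 * |r| ^ (p - 1)) ≤
        2 ^ (p - 1 - a) * 2 ^ (p - 1) / 2 * t ^ (-a) := by
      refine (div_le_div₀ (by positivity) hnum (by positivity)
        (mul_le_mul_of_nonneg_left hden two_pos.le)).trans_eq ?_
      rw [div_rpow ht.le two_pos.le, sub_eq_add_neg (p - 1) a, rpow_add ht]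
      field_simp
    refine (mul_le_mul_of_nonneg_left hint hpre).trans
      ((mul_le_mul_of_nonneg_right hfac (by positivity)).trans_eq ?_)
    rw [sub_eq_add_neg 1 a, rpow_add hδ0, rpow_one]
    ring
end
end

section
/- Let p > 5 be a real number. Then there exists δ₀ > 0 such that for every 0 < δ < δ₀ there exists an infinitely differentiable curve f : (0,∞) → L²(ℝ) (differentiable to all orders in the L² norm, with f', f'' denoting its first two derivatives) with the following properties: (a) ⟨f(λs), f(λt)⟩ = λ^{(2p−6)/(p−1)} ⟨f(s), f(t)⟩ for all s, t, λ > 0; (b) ‖f(1)‖ = √δ and ‖f'(1)‖ = 1/√2; (c) ⟨f(s), f(t)⟩ = 0 whenever t/s > 1.1 or s/t > 1.1; (d) for all distinct s, t > 0, the four vectors f(s), f(t), f'(s), f'(t) are linearly independent in L²(ℝ); (e) ‖f''(1)‖ > √2/(p−1). -/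
open Real MeasureTheory
open scoped RealInnerProductSpace

noncomputable section

open SchwartzMap

/-- The class in `L²(ℝ)` of the translate `x ↦ g (x - u)` of a Schwartz function. -/
def translateL2 (u : ℝ) : 𝓢(ℝ, ℝ) →L[ℝ] Lp ℝ 2 (volume : Measure ℝ) :=
  (toLpCLM ℝ ℝ 2 volume).comp (compSubConstCLM ℝ u)

lemma coeFn_translateL2 (u : ℝ) (g : 𝓢(ℝ, ℝ)) :
    translateL2 u g =ᵐ[volume] fun x => g (x - u) :=
  coeFn_toLp (compSubConstCLM ℝ u g) 2 volume

lemma inner_translateL2 (u v : ℝ) (g h : 𝓢(ℝ, ℝ)) :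
    ⟪translateL2 u g, translateL2 v h⟫ = ∫ x, g (x - u) * h (x - v) := by
  rw [L2.inner_def]
  apply integral_congr_ae
  filter_upwards [coeFn_translateL2 u g, coeFn_translateL2 v h] with x hx hy
  simp [hx, hy, mul_comm]

lemma inner_translateL2_add (c u v : ℝ) (g h : 𝓢(ℝ, ℝ)) :
    ⟪translateL2 (c + u) g, translateL2 (c + v) h⟫ = ⟪translateL2 u g, translateL2 v h⟫ := by
  rw [inner_translateL2, inner_translateL2,
    ← integral_sub_right_eq_self (fun x => g (x - u) * h (x - v)) c]
  simp only [sub_sub]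

lemma inner_translateL2_deriv (u : ℝ) (g h : 𝓢(ℝ, ℝ)) :
    ⟪translateL2 u (derivCLM ℝ ℝ g), translateL2 u h⟫ =
      -⟪translateL2 u g, translateL2 u (derivCLM ℝ ℝ h)⟫ := by
  have key (a b : 𝓢(ℝ, ℝ)) :
      ⟪translateL2 u a, translateL2 u b⟫ = ∫ x, a x * b x := by
    simpa using (inner_translateL2_add u 0 0 a b).trans (inner_translateL2 0 0 a b)
  rw [key, key]
  have := integral_mul_deriv_eq_neg_deriv_mul g h
  simp only [derivCLM_apply]
  linarith

lemma exists_decay_taylor_bound (g : 𝓢(ℝ, ℝ)) :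
    ∃ C : ℝ, ∀ y h : ℝ, |h| ≤ 1 →
      |g (y - h) - g y + h * derivCLM ℝ ℝ g y| ≤ C * (1 + |y|)⁻¹ * |h| * |h| := by
  set g' := derivCLM ℝ ℝ g with hg'
  set g'' := derivCLM ℝ ℝ g' with hg''
  have hd (x : ℝ) : HasDerivAt g (g' x) x := g.differentiableAt.hasDerivAt
  have hd' (x : ℝ) : HasDerivAt g' (g'' x) x := g'.differentiableAt.hasDerivAt
  obtain ⟨C₀, -, h₀⟩ := g''.decay 0 0
  obtain ⟨C₁, -, h₁⟩ := g''.decay 1 0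
  simp only [pow_zero, one_mul, pow_one, norm_iteratedFDeriv_zero, Real.norm_eq_abs] at h₀ h₁
  refine ⟨2 * C₀ + C₁, fun y h hh => ?_⟩
  set M := (2 * C₀ + C₁) * (1 + |y|)⁻¹ with hM
  have hy : 0 < 1 + |y| := by positivity
  set s := Set.Icc (-|h|) |h| with hs
  have h0s : (0 : ℝ) ∈ s := by simp [hs]
  have hhs : h ∈ s := ⟨neg_abs_le h, le_abs_self h⟩
  have bound2 : ∀ k ∈ s, ‖-g'' (y - k)‖ ≤ M := by
    intro k hk
    have hk1 : |k| ≤ 1 := (abs_le.2 hk).trans hh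
    rw [hM, ← div_eq_mul_inv, le_div_iff₀ hy, norm_neg, Real.norm_eq_abs]
    have h2 : |y| ≤ |y - k| + |k| := by simpa using abs_add_le (y - k) k
    nlinarith [h₀ (y - k), h₁ (y - k), abs_nonneg (g'' (y - k))]
  have hsub (k : ℝ) : HasDerivAt (fun k => y - k) (-1) k := by
    simpa using (hasDerivAt_id k).const_sub y
  have bound1 : ∀ k ∈ s, ‖-g' (y - k) + g' y‖ ≤ M * |h| := by
    intro k hk
    have hM0 : 0 ≤ M := (norm_nonneg _).trans (bound2 0 h0s)
    have := (convex_Icc (-|h|) |h|).norm_image_sub_le_of_norm_hasDerivWithin_le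
      (f := fun k => g' (y - k)) (f' := fun k => -g'' (y - k)) (C := M)
      (fun k _ => by simpa [Function.comp_def] using ((hd' (y - k)).comp k (hsub k)).hasDerivWithinAt)
      bound2 h0s hk
    rw [← norm_neg]
    simp only [sub_zero, Real.norm_eq_abs] at this ⊢
    rw [show -(-g' (y - k) + g' y) = g' (y - k) - g' y by ring]
    exact this.trans (mul_le_mul_of_nonneg_left (abs_le.2 hk) hM0)
  have := (convex_Icc (-|h|) |h|).norm_image_sub_le_of_norm_hasDerivWithin_le
      (f := fun k => g (y - k) + k * g' y) (f' := fun k => -g' (y - k) + g' y) (C := M * |h|)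
      (fun k _ => by
        convert (((hd (y - k)).comp k (hsub k)).add
          ((hasDerivAt_id k).mul_const (g' y))).hasDerivWithinAt using 1
        · rfl
        · ring) bound1 h0s hhs
  simp only [sub_zero, Real.norm_eq_abs, zero_mul, add_zero] at this
  rwa [add_sub_right_comm] at this

lemma memLp_inv_one_add_abs_sub (u : ℝ) :
    MemLp (fun x : ℝ => (1 + |x - u|)⁻¹) 2 volume := by
  have hcont : Continuous fun x : ℝ => (1 + |x - u|)⁻¹ :=
    Continuous.inv₀ (by fun_prop) fun x => by positivity
  rw [memLp_two_iff_integrable_sq hcont.aestronglyMeasurable]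
  have := (integrable_one_add_norm (E := ℝ) (μ := volume) (r := 2) (by simp)).comp_sub_right u
  refine this.congr (ae_of_all _ fun x => ?_)
  have : 0 ≤ 1 + |x - u| := by positivity
  simp [Real.rpow_neg this]

lemma hasDerivAt_translateL2 (g : 𝓢(ℝ, ℝ)) (u : ℝ) :
    HasDerivAt (fun v => translateL2 v g) (-translateL2 u (derivCLM ℝ ℝ g)) u := by
  obtain ⟨C, hC⟩ := exists_decay_taylor_bound g
  set D := (memLp_inv_one_add_abs_sub u).toLp
  rw [hasDerivAt_iff_isLittleO_nhds_zero]
  have hO : (fun h => translateL2 (u + h) g - translateL2 u g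
      - h • -translateL2 u (derivCLM ℝ ℝ g)) =O[nhds 0] fun h : ℝ => h * h := by
    refine Asymptotics.IsBigO.of_bound (C * ‖D‖) ?_
    filter_upwards [Metric.closedBall_mem_nhds (0 : ℝ) one_pos] with h hh
    have hh : |h| ≤ 1 := by simpa using hh
    have := Lp.norm_le_mul_norm_of_ae_le_mul (c := C * |h| * |h|) (g := D)
      (f := translateL2 (u + h) g - translateL2 u g - h • -translateL2 u (derivCLM ℝ ℝ g)) ?_
    · rw [norm_mul, Real.norm_eq_abs]
      linarith
    · filter_upwards [Lp.coeFn_sub (translateL2 (u + h) g - translateL2 u g)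
          (h • -translateL2 u (derivCLM ℝ ℝ g)),
        Lp.coeFn_sub (translateL2 (u + h) g) (translateL2 u g),
        Lp.coeFn_smul h (-translateL2 u (derivCLM ℝ ℝ g)),
        Lp.coeFn_neg (translateL2 u (derivCLM ℝ ℝ g)),
        coeFn_translateL2 (u + h) g, coeFn_translateL2 u g,
        coeFn_translateL2 u (derivCLM ℝ ℝ g), (memLp_inv_one_add_abs_sub u).coeFn_toLp]
        with x h1 h2 h3 h4 h5 h6 h7 h8
      have hx : 0 ≤ (1 + |x - u|)⁻¹ := by positivity
      simp only [h1, h2, h3, h4, h5, h6, h7, h8, D, Pi.sub_apply, Pi.smul_apply, Pi.neg_apply,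
        smul_eq_mul, Real.norm_eq_abs, abs_of_nonneg hx, mul_neg, sub_neg_eq_add]
      have := hC (x - u) h hh
      rw [sub_sub] at this
      linarith
  refine hO.trans_isLittleO ?_
  simpa [pow_two] using Asymptotics.isLittleO_pow_id (𝕜 := ℝ) (n := 2) (by norm_num)

/-- The curve `t ↦ t ^ β g(· - log t)`, homogeneous under dilations of `t`. -/
def logTranslate (β : ℝ) (g : 𝓢(ℝ, ℝ)) (t : ℝ) : Lp ℝ 2 (volume : Measure ℝ) :=
  t ^ β • translateL2 (log t) g

lemma hasDerivAt_logTranslate (β : ℝ) (g : 𝓢(ℝ, ℝ)) {t : ℝ} (ht : 0 < t) :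
    HasDerivAt (logTranslate β g) (logTranslate (β - 1) (β • g - derivCLM ℝ ℝ g) t) t := by
  have h1 := Real.hasDerivAt_rpow_const (x := t) (p := β) (Or.inl ht.ne')
  have h2 := (hasDerivAt_translateL2 g (log t)).scomp t (Real.hasDerivAt_log ht.ne')
  refine (h1.smul h2).congr_deriv ?_
  simp only [logTranslate, map_sub, map_smul, Real.rpow_sub_one ht.ne', Function.comp_apply]
  module

lemma deriv_logTranslate (β : ℝ) (g : 𝓢(ℝ, ℝ)) {t : ℝ} (ht : 0 < t) :
    deriv (logTranslate β g) t = logTranslate (β - 1) (β • g - derivCLM ℝ ℝ g) t :=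
  (hasDerivAt_logTranslate β g ht).deriv

lemma contDiffOn_logTranslate (β : ℝ) (g : 𝓢(ℝ, ℝ)) :
    ContDiffOn ℝ (⊤ : ℕ∞) (logTranslate β g) (Set.Ioi 0) := by
  rw [contDiffOn_infty]
  intro n
  induction n generalizing β g with
  | zero =>
    exact contDiffOn_zero.2 fun t ht =>
      (hasDerivAt_logTranslate β g ht).continuousAt.continuousWithinAt
  | succ n ih =>
    push_cast
    rw [contDiffOn_succ_iff_deriv_of_isOpen isOpen_Ioi]
    exact ⟨fun t ht => (hasDerivAt_logTranslate β g ht).differentiableAt.differentiableWithinAt,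
      by simp, (ih _ _).congr fun t ht => deriv_logTranslate β g ht⟩

lemma inner_logTranslate_mul (β : ℝ) (g : 𝓢(ℝ, ℝ)) {l s t : ℝ}
    (hl : 0 < l) (hs : 0 < s) (ht : 0 < t) :
    ⟪logTranslate β g (l * s), logTranslate β g (l * t)⟫ =
      l ^ (2 * β) * ⟪logTranslate β g s, logTranslate β g t⟫ := by
  simp only [logTranslate, real_inner_smul_left, real_inner_smul_right,
    Real.log_mul hl.ne' hs.ne', Real.log_mul hl.ne' ht.ne', inner_translateL2_add,
    Real.mul_rpow hl.le hs.le, Real.mul_rpow hl.le ht.le, two_mul, Real.rpow_add hl]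
  ring

lemma inner_logTranslate_eq_zero (β : ℝ) {g : 𝓢(ℝ, ℝ)} {w : ℝ} (hw : w ≤ 1 / 50)
    (hg : ∀ x, w ≤ |x| → g x = 0) {s t : ℝ} (hs : 0 < s) (ht : 0 < t) (hst : 1.1 < t / s) :
    ⟪logTranslate β g s, logTranslate β g t⟫ = 0 := by
  have hlog : 1 / 11 < log t - log s := by
    rw [← Real.log_div ht.ne' hs.ne']
    have h1 := Real.one_sub_inv_le_log_of_pos (x := 1.1) (by norm_num)
    have h2 := Real.log_lt_log (by norm_num) hst
    norm_num at h1 h2 ⊢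
    linarith
  rw [logTranslate, logTranslate, real_inner_smul_left, real_inner_smul_right,
    inner_translateL2]
  have : (fun x => g (x - log s) * g (x - log t)) = fun _ => 0 := by
    funext x
    by_cases h : w ≤ |x - log s|
    · rw [hg _ h, zero_mul]
    · rw [hg (x - log t), mul_zero]
      have := (abs_lt.1 (not_le.1 h)).2
      exact le_trans (by linarith) (neg_le_abs _)
  simp [this]

lemma eq_zero_of_mul_add_mul_deriv_eq_zero {g : 𝓢(ℝ, ℝ)} {w ε A B : ℝ} (hw : 0 < w) (hε : 0 < ε)
    (hg : g (-w) = 0) (hpos : ∀ x, |x| < w → 0 < g x)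
    (h : ∀ x, x < -w + ε → A * g x + B * derivCLM ℝ ℝ g x = 0) : A = 0 ∧ B = 0 := by
  set r := -w + min w (ε / 2) with hr
  have hm : 0 < min w (ε / 2) := lt_min hw (by linarith)
  have hm1 := min_le_left w (ε / 2)
  have hm2 := min_le_right w (ε / 2)
  have hrpos : 0 < g r := hpos r (abs_lt.2 ⟨by linarith, by linarith⟩)
  by_cases hB : B = 0
  · have := h r (by linarith)
    rw [hB, zero_mul, add_zero] at this
    exact ⟨(mul_eq_zero.1 this).resolve_right hrpos.ne', hB⟩
  exfalso
  have hd (x : ℝ) : HasDerivAt g (derivCLM ℝ ℝ g x) x := g.differentiableAt.hasDerivAt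
  have hE (x : ℝ) : HasDerivAt (fun x => exp (A / B * x) * g x)
      (exp (A / B * x) * (A / B) * g x + exp (A / B * x) * derivCLM ℝ ℝ g x) x := by
    refine ((((hasDerivAt_id x).const_mul (A / B)).exp).mul (hd x)).congr_deriv ?_
    simp
  have := constant_of_has_deriv_right_zero (f := fun x => exp (A / B * x) * g x)
    (a := -w) (b := r) (fun x _ => (hE x).continuousAt.continuousWithinAt)
    (fun x hx => by
      convert (hE x).hasDerivWithinAt using 1
      have := h x (by linarith [hx.2])
      field_simp
      rw [this]; ring) r ⟨by linarith, le_rfl⟩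
  simp [hg, hrpos.ne'] at this

lemma coeff_eq_zero_of_translates {g : 𝓢(ℝ, ℝ)} {w : ℝ} (hw : 0 < w)
    (hg : ∀ x, w ≤ |x| → g x = 0) (hpos : ∀ x, |x| < w → 0 < g x)
    {a b A B C D : ℝ} (hab : a < b)
    (h : ∀ x, A * g (x - a) + B * derivCLM ℝ ℝ g (x - a) +
      (C * g (x - b) + D * derivCLM ℝ ℝ g (x - b)) = 0) :
    A = 0 ∧ B = 0 ∧ C = 0 ∧ D = 0 := by
  have hgw : g (-w) = 0 := hg _ (by rw [abs_neg, abs_of_pos hw])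
  have hd (x : ℝ) (hx : x < -w) : derivCLM ℝ ℝ g x = 0 := by
    have : g =ᶠ[nhds x] fun _ => (0 : ℝ) := by
      filter_upwards [Iio_mem_nhds hx] with y hy
      exact hg y (le_abs.2 (Or.inr (by linarith [Set.mem_Iio.1 hy])))
    rw [derivCLM_apply, this.deriv_eq, deriv_const]
  obtain ⟨rfl, rfl⟩ := eq_zero_of_mul_add_mul_deriv_eq_zero (A := A) (B := B) hw
    (sub_pos.2 hab) hgw hpos fun x hx => by
      have := h (x + a)
      rwa [hg (x + a - b) (le_abs.2 (Or.inr (by linarith))), hd (x + a - b) (by linarith),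
        add_sub_cancel_right, mul_zero, mul_zero, add_zero, add_zero] at this
  obtain ⟨rfl, rfl⟩ := eq_zero_of_mul_add_mul_deriv_eq_zero (A := C) (B := D) hw
    one_pos hgw hpos fun x _ => by simpa using h (x + b)
  simp

lemma linearIndependent_logTranslate (β : ℝ) {g : 𝓢(ℝ, ℝ)} {w : ℝ} (hw : 0 < w)
    (hg : ∀ x, w ≤ |x| → g x = 0) (hpos : ∀ x, |x| < w → 0 < g x)
    {s t : ℝ} (hs : 0 < s) (ht : 0 < t) (hst : s ≠ t) :
    LinearIndependent ℝ ![logTranslate β g s, logTranslate β g t,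
      deriv (logTranslate β g) s, deriv (logTranslate β g) t] := by
  rw [Fintype.linearIndependent_iff]
  intro c hc
  set g' := derivCLM ℝ ℝ g with hg'
  set A := c 0 * s ^ β + c 2 * s ^ (β - 1) * β with hA
  set B := -(c 2 * s ^ (β - 1)) with hB
  set C := c 1 * t ^ β + c 3 * t ^ (β - 1) * β with hC
  set D := -(c 3 * t ^ (β - 1)) with hD
  have hsum : translateL2 (log s) (A • g + B • g') + translateL2 (log t) (C • g + D • g') = 0 := by
    rw [← hc, Fin.sum_univ_four]
    simp only [Matrix.cons_val, deriv_logTranslate β g hs, deriv_logTranslate β g ht,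
      logTranslate, map_add, map_sub, map_smul, ← hg', hA, hB, hC, hD]
    module
  have hae : (fun x => (A • g + B • g') (x - log s) + (C • g + D • g') (x - log t))
      =ᵐ[volume] fun _ => (0 : ℝ) := by
    filter_upwards [Lp.coeFn_add (translateL2 (log s) (A • g + B • g'))
      (translateL2 (log t) (C • g + D • g')), coeFn_translateL2 (log s) (A • g + B • g'),
      coeFn_translateL2 (log t) (C • g + D • g'), Lp.coeFn_zero ℝ 2 (volume : Measure ℝ)]
      with x h1 h2 h3 h4
    rw [hsum, h4, Pi.add_apply, h2, h3] at h1
    exact h1.symm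
  have hcont : Continuous
      fun x => (A • g + B • g') (x - log s) + (C • g + D • g') (x - log t) :=
    ((A • g + B • g').continuous.comp (continuous_sub_right _)).add
      ((C • g + D • g').continuous.comp (continuous_sub_right _))
  have hall := (Continuous.ae_eq_iff_eq volume hcont continuous_const).1 hae
  have hpt (x : ℝ) : A * g (x - log s) + B * g' (x - log s) +
      (C * g (x - log t) + D * g' (x - log t)) = 0 := congrFun hall x
  have hlog : log s ≠ log t := fun h => hst (Real.log_injOn_pos hs ht h)
  have hzero : A = 0 ∧ B = 0 ∧ C = 0 ∧ D = 0 := by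
    rcases hlog.lt_or_gt with h | h
    · exact coeff_eq_zero_of_translates hw hg hpos h hpt
    · obtain ⟨h1, h2, h3, h4⟩ := coeff_eq_zero_of_translates hw hg hpos h
        (A := C) (B := D) (C := A) (D := B) fun x => by rw [add_comm]; exact hpt x
      exact ⟨h3, h4, h1, h2⟩
  obtain ⟨hA0, hB0, hC0, hD0⟩ := hzero
  have hc2 : c 2 = 0 := by simpa [hB, (Real.rpow_pos_of_pos hs _).ne'] using hB0
  have hc3 : c 3 = 0 := by simpa [hD, (Real.rpow_pos_of_pos ht _).ne'] using hD0
  have hc0 : c 0 = 0 := by simpa [hA, hc2, (Real.rpow_pos_of_pos hs _).ne'] using hA0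
  have hc1 : c 1 = 0 := by simpa [hC, hc3, (Real.rpow_pos_of_pos ht _).ne'] using hC0
  intro i
  fin_cases i <;> assumption

/-- Bump functions with prescribed ratio between the `L²` norms of the derivative and of the function,
supported in a small interval once that ratio is large. -/
lemma exists_bump_integral_sq :
    ∃ K₀ : ℝ, 0 < K₀ ∧ ∀ K m : ℝ, K₀ ≤ K → 0 < m → ∃ (g : 𝓢(ℝ, ℝ)) (w : ℝ), 0 < w ∧
      w ≤ 1 / 50 ∧ (∀ x, w ≤ |x| → g x = 0) ∧ (∀ x, |x| < w → 0 < g x) ∧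
      ∫ x, g x ^ 2 = m ∧ ∫ x, derivCLM ℝ ℝ g x ^ 2 = K * m := by
  let b : ContDiffBump (0 : ℝ) := ⟨1, 2, one_pos, one_lt_two⟩
  have hb0 : ∀ x, 2 ≤ |x| → b x = 0 := fun x hx => b.zero_of_le_dist (by simpa using hx)
  have hbpos : ∀ x, |x| < 2 → 0 < b x := fun x hx => b.pos_of_mem_ball (by simpa using hx)
  have hbs : ContDiff ℝ (⊤ : ℕ∞) b := b.contDiff
  have hbd (x : ℝ) : HasDerivAt b (deriv b x) x :=
    (hbs.differentiable (by simp) x).hasDerivAt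
  have hN₀ : 0 < ∫ x, b x ^ 2 := by
    refine Continuous.integral_pos_of_hasCompactSupport_nonneg_nonzero (x := 0)
      (b.continuous.pow 2) ?_ (fun x => sq_nonneg _)
      (pow_ne_zero 2 (hbpos 0 (by simp)).ne')
    exact b.hasCompactSupport.comp_left (g := fun y : ℝ => y ^ 2) (by simp)
  have hN₁ : 0 < ∫ x, deriv b x ^ 2 := by
    obtain ⟨x, hx⟩ : ∃ x, deriv b x ≠ 0 := by
      by_contra! h
      have := is_const_of_deriv_eq_zero (hbs.differentiable (by simp)) h 0 2
      rw [hb0 2 (by simp)] at this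
      exact (hbpos 0 (by simp)).ne' this
    refine Continuous.integral_pos_of_hasCompactSupport_nonneg_nonzero (x := x)
      ((hbs.continuous_deriv (by simp)).pow 2) ?_ (fun x => sq_nonneg _) (pow_ne_zero 2 hx)
    exact b.hasCompactSupport.deriv.comp_left (g := fun y : ℝ => y ^ 2) (by simp)
  set N₀ := ∫ x, b x ^ 2
  set N₁ := ∫ x, deriv b x ^ 2
  refine ⟨10000 * (N₁ / N₀), by positivity, fun K m hK hm => ?_⟩
  have hK0 : 0 < K := lt_of_lt_of_le (by positivity) hK
  set r := √(N₁ / (N₀ * K)) with hr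
  have hr0 : 0 < r := Real.sqrt_pos.2 (by positivity)
  have hr2 : r ^ 2 = N₁ / (N₀ * K) := Real.sq_sqrt (by positivity)
  have hr1 : r ≤ 1 / 100 := by
    refine Real.sqrt_le_iff.2 ⟨by norm_num, ?_⟩
    rw [← mul_div_assoc, div_le_iff₀ hN₀] at hK
    rw [div_le_iff₀ (by positivity)]
    linarith
  set a := √(m / (r * N₀)) with ha
  have ha0 : 0 < a := Real.sqrt_pos.2 (by positivity)
  have ha2 : a ^ 2 = m / (r * N₀) := Real.sq_sqrt (by positivity)
  have hsupp : HasCompactSupport fun x => a * b (x / r) := by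
    refine HasCompactSupport.intro (isCompact_closedBall (0 : ℝ) (2 * r)) fun x hx => ?_
    have : 2 * r < |x| := by simpa using hx
    rw [hb0, mul_zero]
    rw [abs_div, abs_of_pos hr0, le_div_iff₀ hr0]
    exact this.le
  have hsmooth : ContDiff ℝ (⊤ : ℕ∞) fun x => a * b (x / r) :=
    contDiff_const.mul (hbs.comp (contDiff_id.div_const r))
  let g : 𝓢(ℝ, ℝ) := hsupp.toSchwartzMap hsmooth
  have hgx (x : ℝ) : g x = a * b (x / r) := rfl
  have hg'x (x : ℝ) : derivCLM ℝ ℝ g x = a / r * deriv b (x / r) := by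
    have := (hbd (x / r)).comp x ((hasDerivAt_id x).div_const r)
    rw [derivCLM_apply]
    exact (this.const_mul a).deriv.trans (by ring)
  refine ⟨g, 2 * r, by positivity, by linarith, fun x hx => ?_, fun x hx => ?_, ?_, ?_⟩
  · rw [hgx, hb0, mul_zero]
    rwa [abs_div, abs_of_pos hr0, le_div_iff₀ hr0]
  · refine mul_pos ha0 (hbpos _ ?_)
    rwa [abs_div, abs_of_pos hr0, div_lt_iff₀ hr0]
  · simp only [hgx, mul_pow]
    rw [integral_const_mul, Measure.integral_comp_div (fun x => b x ^ 2) r, abs_of_pos hr0, ha2,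
      smul_eq_mul]
    change m / (r * N₀) * (r * N₀) = m
    field_simp
  · simp only [hg'x, mul_pow, div_pow]
    rw [integral_const_mul, Measure.integral_comp_div (fun x => deriv b x ^ 2) r, abs_of_pos hr0,
      ha2, hr2, smul_eq_mul]
    change m / (r * N₀) / (N₁ / (N₀ * K)) * (r * N₁) = K * m
    field_simp

/-- the final construction of Section 6: the curve `t ↦ f(t)` in
`L²(ℝ)` obeying (6.15), (6.17), (6.19), (6.20), (6.21), (6.23). -/
theorem stmt16 (p : ℝ) (hp : 5 < p) :
    ∃ δ₀ : ℝ, 0 < δ₀ ∧ ∀ δ : ℝ, 0 < δ → δ < δ₀ →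
      ∃ f : ℝ → Lp ℝ 2 (volume : Measure ℝ),
        -- infinitely differentiable curve on `(0,∞)`
        ContDiffOn ℝ (⊤ : ℕ∞) f (Set.Ioi 0) ∧
        -- (a) scaling symmetry of the Gram matrix
        (∀ l s t : ℝ, 0 < l → 0 < s → 0 < t →
          ⟪f (l * s), f (l * t)⟫ = l ^ ((2 * p - 6) / (p - 1)) * ⟪f s, f t⟫) ∧
        -- (b) normalisations
        ‖f 1‖ = Real.sqrt δ ∧
        ‖deriv f 1‖ = 1 / Real.sqrt 2 ∧
        -- (c) long-range orthogonality
        (∀ s t : ℝ, 0 < s → 0 < t → (1.1 < t / s ∨ 1.1 < s / t) → ⟪f s, f t⟫ = 0) ∧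
        -- (d) linear independence
        (∀ s t : ℝ, 0 < s → 0 < t → s ≠ t →
          LinearIndependent ℝ ![f s, f t, deriv f s, deriv f t]) ∧
        -- (e)
        Real.sqrt 2 / (p - 1) < ‖deriv (deriv f) 1‖ := by
  obtain ⟨K₀, hK₀, hbump⟩ := exists_bump_integral_sq
  refine ⟨min (1 / 4) (1 / (4 * K₀)), by positivity, fun δ hδ hδ₀ => ?_⟩
  have hδ1 : δ < 1 / 4 := hδ₀.trans_le (min_le_left _ _)
  have hδ2 : δ < 1 / (4 * K₀) := hδ₀.trans_le (min_le_right _ _)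
  have hp1 : 0 < p - 1 := by linarith
  set α := (p - 3) / (p - 1) with hα
  have hα0 : 1 / 2 < α := by rw [hα, lt_div_iff₀ hp1]; linarith
  have hα1 : α < 1 := by rw [hα, div_lt_one hp1]; linarith
  have hα2 : α ^ 2 * δ ≤ δ :=
    mul_le_of_le_one_left hδ.le (pow_le_one₀ (by linarith) hα1.le)
  obtain ⟨g, w, hw, hw1, hg0, hgpos, hm, hm'⟩ := hbump ((1 / 2 - α ^ 2 * δ) / δ) δ
    (by
      rw [lt_div_iff₀ (by positivity)] at hδ2
      rw [le_div_iff₀ hδ]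
      linarith) hδ
  rw [div_mul_cancel₀ _ hδ.ne'] at hm'
  set φ := translateL2 0 g with hφ
  set φ' := translateL2 0 (derivCLM ℝ ℝ g) with hφ'
  set φ'' := translateL2 0 (derivCLM ℝ ℝ (derivCLM ℝ ℝ g)) with hφ''
  have i00 : ⟪φ, φ⟫ = δ := by
    rw [hφ, inner_translateL2]; simpa only [sub_zero, ← pow_two] using hm
  have i11 : ⟪φ', φ'⟫ = 1 / 2 - α ^ 2 * δ := by
    rw [hφ', inner_translateL2]; simpa only [sub_zero, ← pow_two] using hm'
  have i10 : ⟪φ', φ⟫ = 0 := by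
    have := inner_translateL2_deriv 0 g g
    rw [real_inner_comm] at this
    rw [real_inner_comm]
    linarith
  have i20 : ⟪φ'', φ⟫ = -(1 / 2 - α ^ 2 * δ) := by
    rw [← i11]; exact inner_translateL2_deriv 0 (derivCLM ℝ ℝ g) g
  have hone (β : ℝ) (h : SchwartzMap ℝ ℝ) : logTranslate β h 1 = translateL2 0 h := by
    simp [logTranslate]
  have hφn : ‖φ‖ = √δ := by rw [← i00, real_inner_self_eq_norm_sq, Real.sqrt_sq (norm_nonneg _)]
  have hder1 : deriv (logTranslate α g) 1 = α • φ - φ' := by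
    rw [deriv_logTranslate α g one_pos, hone, map_sub, map_smul]
  have hder2 : deriv (deriv (logTranslate α g)) 1 =
      (α - 1) • (α • φ - φ') - (α • φ' - φ'') := by
    have : deriv (logTranslate α g) =ᶠ[nhds 1]
        logTranslate (α - 1) (α • g - SchwartzMap.derivCLM ℝ ℝ g) := by
      filter_upwards [Ioi_mem_nhds one_pos] with t ht using deriv_logTranslate α g ht
    rw [this.deriv_eq, deriv_logTranslate _ _ one_pos, hone]
    simp only [map_sub, map_smul, hφ, hφ', hφ'']
  refine ⟨logTranslate α g, contDiffOn_logTranslate α g, fun l s t hl hs ht => ?_, ?_, ?_, ?_,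
    fun s t hs ht hst => linearIndependent_logTranslate α hw hg0 hgpos hs ht hst, ?_⟩
  · rw [inner_logTranslate_mul α g hl hs ht, hα]
    congr 2
    ring
  · rw [hone, hφn]
  · rw [hder1, ← Real.sqrt_sq (norm_nonneg (α • φ - φ')), ← real_inner_self_eq_norm_sq,
      inner_sub_left, inner_sub_right, inner_sub_right]
    simp only [real_inner_smul_left, real_inner_smul_right, real_inner_comm φ' φ, i00, i10, i11]
    rw [← Real.sqrt_one, ← Real.sqrt_div zero_le_one]
    congr 1
    norm_num
    ring
  · rintro s t hs ht (h | h)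
    · exact inner_logTranslate_eq_zero α hw1 hg0 hs ht h
    · rw [real_inner_comm]
      exact inner_logTranslate_eq_zero α hw1 hg0 ht hs h
  · rw [hder2]
    set χ := (α - 1) • (α • φ - φ') - (α • φ' - φ'') with hχ
    have hin : ⟪χ, φ⟫ = (α - 1) * α * δ - (1 / 2 - α ^ 2 * δ) := by
      simp only [hχ, inner_sub_left, real_inner_smul_left, i00, i10, i20]
      ring
    have hcs := abs_real_inner_le_norm χ φ
    rw [hin, hφn, abs_sub_comm] at hcs
    have hlow := (le_abs_self _).trans hcs
    have hsδ : √δ < 1 / 2 := by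
      rw [Real.sqrt_lt' (by norm_num)]; linarith
    have hχ2 : 1 / 2 < ‖χ‖ := by
      have : 1 / 4 < ‖χ‖ * √δ := by nlinarith
      nlinarith [norm_nonneg χ]
    have h2 : √2 < 2 := by rw [Real.sqrt_lt' (by norm_num)]; norm_num
    have : √2 / (p - 1) < 1 / 2 := by rw [div_lt_iff₀ hp1]; linarith
    exact this.trans hχ2
end
end

section
/- For every a > 0 there exists δ₀ > 0 such that for every 0 < δ < δ₀ there exists a smooth function ψ : ℝ → ℝ whose closed support (the closure of {x : ψ(x) ≠ 0}) is exactly the interval [0, a], and which satisfies ∫_ℝ ψ(x)² dx = δ and ∫_ℝ ψ'(x)² dx = 1/2. -/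
open Real MeasureTheory

noncomputable section

theorem continuous_integral_sq_lineMap {f g : ℝ → ℝ} (hf : Continuous f) (hg : Continuous g)
    (hfs : HasCompactSupport f) (hgs : HasCompactSupport g) :
    Continuous fun t : ℝ => ∫ x, ((1 - t) * f x + t * g x) ^ 2 := by
  have hff : Integrable fun x => f x * f x :=
    (hf.mul hf).integrable_of_hasCompactSupport hfs.mul_left
  have hfg : Integrable fun x => f x * g x :=
    (hf.mul hg).integrable_of_hasCompactSupport hgs.mul_left
  have hgg : Integrable fun x => g x * g x :=
    (hg.mul hg).integrable_of_hasCompactSupport hgs.mul_left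
  have key : (fun t : ℝ => ∫ x, ((1 - t) * f x + t * g x) ^ 2) = fun t =>
      (1 - t) ^ 2 * (∫ x, f x * f x) + 2 * (1 - t) * t * (∫ x, f x * g x)
        + t ^ 2 * ∫ x, g x * g x := by
    funext t
    rw [← integral_const_mul, ← integral_const_mul, ← integral_const_mul,
      ← integral_add (hff.const_mul _) (hfg.const_mul _), ← integral_add _ (hgg.const_mul _)]
    rotate_left
    · exact (hff.const_mul _).add (hfg.const_mul _)
    refine integral_congr_ae (.of_forall fun x => ?_)
    simp only []
    ring
  rw [key]
  fun_prop

theorem integral_sq_pos {f : ℝ → ℝ} (hf : Continuous f) (hfs : HasCompactSupport f)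
    {x : ℝ} (hx : f x ≠ 0) : 0 < ∫ y, f y ^ 2 := by
  have hs : HasCompactSupport fun y => f y ^ 2 :=
    hfs.comp_left (g := fun y : ℝ => y ^ 2) (by simp)
  exact (hf.pow 2).integral_pos_of_hasCompactSupport_nonneg_nonzero hs
    (fun y => sq_nonneg _) (pow_ne_zero 2 hx)

/-- A smooth function that is positive on `(0, a)` and vanishes elsewhere. -/
def intervalBump (a x : ℝ) : ℝ := expNegInvGlue x * expNegInvGlue (a - x)

theorem contDiff_intervalBump (a : ℝ) : ContDiff ℝ (⊤ : ℕ∞) (intervalBump a) :=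
  expNegInvGlue.contDiff.mul (expNegInvGlue.contDiff.comp (contDiff_const.sub contDiff_id))

theorem intervalBump_nonneg (a x : ℝ) : 0 ≤ intervalBump a x :=
  mul_nonneg (expNegInvGlue.nonneg _) (expNegInvGlue.nonneg _)

theorem intervalBump_pos {a x : ℝ} (hx : x ∈ Set.Ioo 0 a) : 0 < intervalBump a x :=
  mul_pos (expNegInvGlue.pos_of_pos hx.1) (expNegInvGlue.pos_of_pos (sub_pos.2 hx.2))

theorem intervalBump_eq_zero {a x : ℝ} (hx : x ∉ Set.Ioo 0 a) : intervalBump a x = 0 := by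
  rw [Set.mem_Ioo, not_and_or, not_lt, not_lt] at hx
  rcases hx with h | h
  · simp [intervalBump, expNegInvGlue.zero_of_nonpos h]
  · simp [intervalBump, expNegInvGlue.zero_of_nonpos (sub_nonpos.2 h)]

theorem hasCompactSupport_intervalBump (a : ℝ) : HasCompactSupport (intervalBump a) :=
  HasCompactSupport.intro isCompact_Icc fun _ hx =>
    intervalBump_eq_zero fun h => hx (Set.Ioo_subset_Icc_self h)

theorem exists_deriv_intervalBump_ne_zero {a : ℝ} (ha : 0 < a) :
    ∃ x, deriv (intervalBump a) x ≠ 0 := by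
  by_contra! h
  have h0 := is_const_of_deriv_eq_zero
    ((contDiff_intervalBump a).differentiable (by simp)) h (a / 2) 0
  rw [intervalBump_eq_zero (x := 0) (by simp)] at h0
  exact (intervalBump_pos ⟨half_pos ha, half_lt_self ha⟩).ne' h0

/-- existence of the bump function `ψ` in Section 6.  For each `a > 0`
and all sufficiently small `δ > 0` there is a smooth `ψ : ℝ → ℝ` with closed support
exactly `[0, a]`, `∫ ψ² = δ` and `∫ (ψ')² = 1/2`. -/
theorem stmt17 (a : ℝ) (ha : 0 < a) :
    ∃ δ₀ : ℝ, 0 < δ₀ ∧ ∀ δ : ℝ, 0 < δ → δ < δ₀ →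
      ∃ ψ : ℝ → ℝ,
        ContDiff ℝ (⊤ : ℕ∞) ψ ∧
        tsupport ψ = Set.Icc 0 a ∧
        (∫ x, ψ x ^ 2) = δ ∧
        (∫ x, (deriv ψ x) ^ 2) = 1 / 2 := by
  set φ := intervalBump a with hφ
  have hc : ContDiff ℝ (⊤ : ℕ∞) φ := contDiff_intervalBump a
  have hs : HasCompactSupport φ := hasCompactSupport_intervalBump a
  have hd : Differentiable ℝ φ := hc.differentiable (by simp)
  have hc' : Continuous (deriv φ) := hc.continuous_deriv (by simp)
  have hmid : a / 2 ∈ Set.Ioo 0 a := ⟨half_pos ha, half_lt_self ha⟩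
  set D := ∫ x, φ x ^ 2 with hD
  set N := ∫ x, deriv φ x ^ 2 with hN
  have hDpos : 0 < D := integral_sq_pos hc.continuous hs (intervalBump_pos hmid).ne'
  have hNpos : 0 < N := by
    obtain ⟨x, hx⟩ := exists_deriv_intervalBump_ne_zero ha
    exact integral_sq_pos hc' hs.deriv hx
  refine ⟨D / (2 * N), by positivity, fun δ hδ hlt => ?_⟩
  rw [lt_div_iff₀ (by positivity)] at hlt
  -- A contraction `x ↦ φ (s * x)` whose energy quotient exceeds `1 / (2 * δ)`.
  obtain ⟨s, hs1, hsN⟩ : ∃ s : ℝ, 1 < s ∧ D < 2 * δ * N * s := by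
    refine ⟨D / (δ * N), ?_, ?_⟩
    · rw [lt_div_iff₀ (by positivity)]
      nlinarith [mul_pos hδ hNpos]
    · have : 2 * δ * N * (D / (δ * N)) = 2 * D := by field_simp
      linarith
  have hs0 : 0 < s := one_pos.trans hs1
  let η : ℝ → ℝ := fun x => φ (s * x)
  have hηc : ContDiff ℝ (⊤ : ℕ∞) η := hc.comp (contDiff_const.mul contDiff_id)
  have hηd : Differentiable ℝ η := hηc.differentiable (by simp)
  have hη0 : ∀ x, x ∉ Set.Ioo 0 a → η x = 0 := fun x hx =>
    intervalBump_eq_zero fun h => hx ⟨pos_of_mul_pos_right h.1 hs0.le, by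
      have := pos_of_mul_pos_right h.1 hs0.le
      nlinarith [h.2]⟩
  have hηs : HasCompactSupport η := HasCompactSupport.intro isCompact_Icc fun x hx =>
    hη0 x fun h => hx (Set.Ioo_subset_Icc_self h)
  have hηc' : Continuous (deriv η) := hηc.continuous_deriv (by simp)
  have hηD : ∫ x, η x ^ 2 = s⁻¹ * D := by
    have := Measure.integral_comp_mul_left (fun x => φ x ^ 2) s
    rwa [abs_of_pos (inv_pos.2 hs0), smul_eq_mul] at this
  have hηN : ∫ x, deriv η x ^ 2 = s * N := by
    have h1 : ∀ x, deriv η x = s * deriv φ (s * x) := fun x => by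
      simpa using deriv_comp_mul_left s φ x
    have := Measure.integral_comp_mul_left (fun x => deriv φ x ^ 2) s
    rw [abs_of_pos (inv_pos.2 hs0), smul_eq_mul] at this
    simp_rw [h1, mul_pow]
    rw [integral_const_mul, this]
    field_simp
    rfl
  obtain ⟨t, ⟨ht0, ht1⟩, ht⟩ : ∃ t ∈ Set.Ioo (0 : ℝ) 1,
      2 * δ * (∫ x, ((1 - t) * deriv φ x + t * deriv η x) ^ 2)
        - (∫ x, ((1 - t) * φ x + t * η x) ^ 2) = 0 := by
    have hcont : Continuous fun t : ℝ =>
        2 * δ * (∫ x, ((1 - t) * deriv φ x + t * deriv η x) ^ 2)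
          - (∫ x, ((1 - t) * φ x + t * η x) ^ 2) :=
      (continuous_const.mul (continuous_integral_sq_lineMap hc' hηc' hs.deriv hηs.deriv)).sub
        (continuous_integral_sq_lineMap hc.continuous hηc.continuous hs hηs)
    refine intermediate_value_Ioo zero_le_one hcont.continuousOn ⟨?_, ?_⟩
    · simp only [sub_zero, one_mul, zero_mul, add_zero, ← hD, ← hN]
      linarith
    · simp only [sub_self, one_mul, zero_mul, zero_add, hηD, hηN]
      have : s⁻¹ * D < 1 * D := by gcongr; exact inv_lt_one_of_one_lt₀ hs1
      linarith
  set χ : ℝ → ℝ := fun x => (1 - t) * φ x + t * η x with hχ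
  have hχc : ContDiff ℝ (⊤ : ℕ∞) χ :=
    (contDiff_const.mul hc).add (contDiff_const.mul hηc)
  have hχpos : ∀ x ∈ Set.Ioo 0 a, 0 < χ x := fun x hx =>
    add_pos_of_pos_of_nonneg (mul_pos (sub_pos.2 ht1) (intervalBump_pos hx))
      (mul_nonneg ht0.le (intervalBump_nonneg _ _))
  have hχ0 : ∀ x, x ∉ Set.Ioo 0 a → χ x = 0 := fun x hx => by
    simp [hχ, hφ, intervalBump_eq_zero hx, hη0 x hx]
  have hχs : HasCompactSupport χ := HasCompactSupport.intro isCompact_Icc fun x hx =>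
    hχ0 x fun h => hx (Set.Ioo_subset_Icc_self h)
  have hχ' : ∀ x, deriv χ x = (1 - t) * deriv φ x + t * deriv η x := fun x =>
    (((hd x).hasDerivAt.const_mul _).add ((hηd x).hasDerivAt.const_mul _)).deriv
  simp_rw [← hχ'] at ht
  change 2 * δ * (∫ x, deriv χ x ^ 2) - (∫ x, χ x ^ 2) = 0 at ht
  have hE : 0 < ∫ x, χ x ^ 2 := integral_sq_pos hχc.continuous hχs (hχpos _ hmid).ne'
  set E := ∫ x, χ x ^ 2
  set c := √(δ / E)
  have hc0 : 0 < c := Real.sqrt_pos.2 (by positivity)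
  have hc2 : c ^ 2 = δ / E := Real.sq_sqrt (by positivity)
  refine ⟨fun x => c * χ x, contDiff_const.mul hχc, ?_, ?_, ?_⟩
  · have : Function.support (fun x => c * χ x) = Set.Ioo 0 a := by
      ext x
      rw [Function.mem_support]
      refine ⟨fun h => ?_, fun h => (mul_pos hc0 (hχpos x h)).ne'⟩
      by_contra hx
      exact h (by rw [hχ0 x hx, mul_zero])
    rw [tsupport, this, closure_Ioo ha.ne]
  · simp_rw [mul_pow]
    rw [integral_const_mul, hc2]
    exact div_mul_cancel₀ _ hE.ne'
  · have h1 : ∀ x, deriv (fun x => c * χ x) x = c * deriv χ x := fun x =>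
      ((hχc.differentiable (by simp) x).hasDerivAt.const_mul c).deriv
    simp_rw [h1, mul_pow]
    rw [integral_const_mul, hc2]
    field_simp
    linarith
end
end
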